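/- arXiv:1707.08918 — 3 statements merged into one kernel-verified Lean document; each statement's English description precedes it below -/
import Mathlib

section
/- Let G be any (house, bull)-free graph. Then at least one of the following holds: (1) G has a proper homogeneous set that is not a stable set; (2) G is C_5-free and P_5-free; (3) G is triangle-free. -/
open SimpleGraph

/-- The bull graph: vertices a,b,c,d,e = 0,1,2,3,4; edges ab,bc,cd,be,ce. -/
def bull : SimpleGraph (Fin 5) :=
  SimpleGraph.fromEdgeSet {s(0,1), s(1,2), s(2,3), s(1,4), s(2,4)}

/-- The house graph: complement of the path on five vertices. -/
def house : SimpleGraph (Fin 5) := (SimpleGraph.pathGraph 5)ᶜ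

/-- `G` contains no induced subgraph isomorphic to `F`. -/
def FreeOf {V W : Type*} (G : SimpleGraph V) (F : SimpleGraph W) : Prop :=
  ¬ ∃ f : W ↪ V, ∀ a b : W, G.Adj (f a) (f b) ↔ F.Adj a b

/-- A homogeneous set: every outside vertex is complete or anticomplete to it. -/
def IsHomogSet {V : Type*} (G : SimpleGraph V) (S : Set V) : Prop :=
  ∀ v ∉ S, (∀ s ∈ S, G.Adj v s) ∨ (∀ s ∈ S, ¬ G.Adj v s)

/-- A proper homogeneous set: at least two vertices and not all of `V`. -/
def IsProperHomogSet {V : Type*} (G : SimpleGraph V) (S : Set V) : Prop :=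
  IsHomogSet G S ∧ S.Nontrivial ∧ S ≠ Set.univ

/-- A stable (independent) set. -/
def IsStableSet {V : Type*} (G : SimpleGraph V) (S : Set V) : Prop :=
  S.Pairwise fun u v => ¬ G.Adj u v

/-- A module: a nonempty homogeneous set that overlaps no homogeneous set. -/
def IsModuleSet {V : Type*} (G : SimpleGraph V) (M : Set V) : Prop :=
  M.Nonempty ∧ IsHomogSet G M ∧
    ∀ S : Set V, IsHomogSet G S → S ⊆ M ∨ M ⊆ S ∨ S ∩ M = ∅

/-- A quasi-maximal module: a module, different from `V`, such that the only
module strictly containing it is `V`. -/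
def IsQuasiMaxModule {V : Type*} (G : SimpleGraph V) (M : Set V) : Prop :=
  IsModuleSet G M ∧ M ≠ Set.univ ∧
    ∀ S : Set V, IsModuleSet G S → M ⊂ S → S = Set.univ

/-- A clique cover: a partition of the vertex set into cliques. -/
def IsCliqueCover {V : Type*} (G : SimpleGraph V) (C : Set (Set V)) : Prop :=
  Setoid.IsPartition C ∧ ∀ Q ∈ C, G.IsClique Q

/-- `cc G`: the minimum number of cliques in a clique cover of `G`. -/
noncomputable def cliqueCoverNumber {V : Type*} (G : SimpleGraph V) : ℕ :=
  sInf {n | ∃ C : Set (Set V), IsCliqueCover G C ∧ C.ncard = n}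

/-- `S` is complete to `T`: every vertex of `S` is adjacent to every vertex of `T`. -/
def CompleteTo {V : Type*} (G : SimpleGraph V) (S T : Set V) : Prop :=
  ∀ s ∈ S, ∀ t ∈ T, G.Adj s t

/-- `S` is anticomplete to `T`: no vertex of `S` is adjacent to a vertex of `T`. -/
def AnticompleteTo {V : Type*} (G : SimpleGraph V) (S T : Set V) : Prop :=
  ∀ s ∈ S, ∀ t ∈ T, ¬ G.Adj s t

/-- The 5-tuple setup from the paper: five nonempty pairwise disjoint sets
`A 0, …, A 4` (corresponding to `A_1, …, A_5`, indices modulo 5) with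
`A i` complete to `A (i+1)` for `i ∈ {0,1,2,3}`, `A i` anticomplete to
`A (i+2)` for all `i`, and `A 4` complete or anticomplete to `A 0`. -/
def GoodTuple {V : Type*} (G : SimpleGraph V) (A : Fin 5 → Set V) : Prop :=
  (∀ i, (A i).Nonempty) ∧
  (Pairwise fun i j => Disjoint (A i) (A j)) ∧
  (∀ i : Fin 5, i ≠ 4 → CompleteTo G (A i) (A (i + 1))) ∧
  (∀ i : Fin 5, AnticompleteTo G (A i) (A (i + 2))) ∧
  (CompleteTo G (A 4) (A 0) ∨ AnticompleteTo G (A 4) (A 0))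

/-- A good tuple whose union `A` is inclusionwise maximal among all good tuples. -/
def MaximalGoodTuple {V : Type*} (G : SimpleGraph V) (A : Fin 5 → Set V) : Prop :=
  GoodTuple G A ∧ ∀ A' : Fin 5 → Set V, GoodTuple G A' → ¬ (⋃ i, A i) ⊂ (⋃ i, A' i)

/-- The set `B` of vertices outside `A` that are complete to `A`. -/
def Bset {V : Type*} (G : SimpleGraph V) (A : Fin 5 → Set V) : Set V :=
  {v | v ∉ (⋃ i, A i) ∧ ∀ a ∈ ⋃ i, A i, G.Adj v a}

/-! ### Elementary forms of the forbidden subgraphs -/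

lemma no_bull {V : Type*} {G : SimpleGraph V} (hB : FreeOf G bull) (a b c d e : V)
    (h1 : G.Adj a b) (h2 : G.Adj b c) (h3 : G.Adj c d) (h4 : G.Adj b e) (h5 : G.Adj c e)
    (n1 : ¬ G.Adj a c) (n2 : ¬ G.Adj a d) (n3 : ¬ G.Adj a e) (n4 : ¬ G.Adj b d)
    (n5 : ¬ G.Adj d e) : False := by
  have e1 : a ≠ c := by rintro rfl; exact n2 h3
  have e2 : a ≠ d := by rintro rfl; exact n4 h1.symm
  have e3 : a ≠ e := by rintro rfl; exact n1 h5.symm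
  have e4 : b ≠ d := by rintro rfl; exact n2 h1
  have e5 : d ≠ e := by rintro rfl; exact n4 h4
  have := h1.ne
  have := h2.ne
  have := h3.ne
  have := h4.ne
  have := h5.ne
  have n1' : ¬ G.Adj c a := fun h => n1 h.symm
  have n2' : ¬ G.Adj d a := fun h => n2 h.symm
  have n3' : ¬ G.Adj e a := fun h => n3 h.symm
  have n4' : ¬ G.Adj d b := fun h => n4 h.symm
  have n5' : ¬ G.Adj e d := fun h => n5 h.symm
  apply hB
  refine ⟨⟨![a, b, c, d, e], ?_⟩, ?_⟩
  · intro i j hij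
    fin_cases i <;> fin_cases j <;> simp_all
  · intro i j
    change G.Adj (![a, b, c, d, e] i) (![a, b, c, d, e] j) ↔ _
    fin_cases i <;> fin_cases j <;> simp [bull, h1, h2, h3, h4, h5, n1, n2, n3, n4, n5,
      n1', n2', n3', n4', n5', h1.symm, h2.symm, h3.symm, h4.symm, h5.symm]

lemma no_house {V : Type*} {G : SimpleGraph V} (hB : FreeOf G house) (o p q r s : V)
    (h1 : G.Adj p q) (h2 : G.Adj q r) (h3 : G.Adj r s) (h4 : G.Adj s p) (h5 : G.Adj o p)
    (h6 : G.Adj o q)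
    (n1 : ¬ G.Adj p r) (n2 : ¬ G.Adj q s) (n3 : ¬ G.Adj o r) (n4 : ¬ G.Adj o s) : False := by
  have e1 : p ≠ r := by rintro rfl; exact n3 h5
  have e2 : q ≠ s := by rintro rfl; exact n4 h6
  have e3 : o ≠ r := by rintro rfl; exact n1 h5.symm
  have e4 : o ≠ s := by rintro rfl; exact n2 h6.symm
  have := h1.ne
  have := h2.ne
  have := h3.ne
  have := h4.ne
  have := h5.ne
  have := h6.ne
  have n1' : ¬ G.Adj r p := fun h => n1 h.symm
  have n2' : ¬ G.Adj s q := fun h => n2 h.symm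
  have n3' : ¬ G.Adj r o := fun h => n3 h.symm
  have n4' : ¬ G.Adj s o := fun h => n4 h.symm
  apply hB
  refine ⟨⟨![p, r, o, s, q], ?_⟩, ?_⟩
  · intro i j hij
    fin_cases i <;> fin_cases j <;> simp_all
  · intro i j
    change G.Adj (![p, r, o, s, q] i) (![p, r, o, s, q] j) ↔ _
    fin_cases i <;> fin_cases j <;> simp [house, SimpleGraph.pathGraph_adj, h1, h2, h3, h4, h5, h6,
      n1, n2, n3, n4, n1', n2', n3', n4',
      h1.symm, h2.symm, h3.symm, h4.symm, h5.symm, h6.symm]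

/-- Connected, triangle-free, (false-)twin-free vertex sets with at least five vertices. -/
structure GoodSet {V : Type*} (G : SimpleGraph V) (H : Finset V) : Prop where
  card : 5 ≤ H.card
  tri : ∀ x ∈ H, ∀ y ∈ H, ∀ z ∈ H, G.Adj x y → G.Adj y z → G.Adj x z → False
  twin : ∀ x ∈ H, ∀ y ∈ H, x ≠ y → ∃ z ∈ H, ¬ (G.Adj x z ↔ G.Adj y z)
  conn : ∀ S : Set V, (∃ x ∈ H, x ∈ S) → (∀ x ∈ H, x ∈ S → ∀ y ∈ H, G.Adj x y → y ∈ S) →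
    ∀ y ∈ H, y ∈ S

/-- Good sets of maximum size. -/
def MaxGood {V : Type*} (G : SimpleGraph V) (H : Finset V) : Prop :=
  GoodSet G H ∧ ∀ H' : Finset V, GoodSet G H' → H'.card ≤ H.card

/-- `v` looks like `h` on `H`, except possibly at `h` itself. -/
def Tw {V : Type*} (G : SimpleGraph V) (H : Finset V) (v h : V) : Prop :=
  ∀ x ∈ H, x ≠ h → (G.Adj v x ↔ G.Adj h x)

section
variable {V : Type*} {G : SimpleGraph V} {H : Finset V}

/-- A good set is not contained in a set of four vertices. -/
lemma GoodSet.big (g : GoodSet G H) (a b c d : V) : ∃ x ∈ H, x ≠ a ∧ x ≠ b ∧ x ≠ c ∧ x ≠ d := by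
  classical
  by_contra hc
  push Not at hc
  have : H ⊆ {a, b, c, d} := by
    intro x hx
    have := hc x hx
    simp only [Finset.mem_insert, Finset.mem_singleton]
    tauto
  have h1 := Finset.card_le_card this
  have h2 : ({a, b, c, d} : Finset V).card ≤ 4 := Finset.card_le_four
  have := g.card
  omega

lemma GoodSet.nbr (g : GoodSet G H) {h : V} (hh : h ∈ H) : ∃ k ∈ H, G.Adj h k := by
  by_contra hc
  push Not at hc
  obtain ⟨x, hx, h1, -⟩ := g.big h h h h
  have := g.conn {h} ⟨h, hh, rfl⟩ (by
    rintro x hx rfl y hy hxy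
    exact absurd hxy (hc y hy)) x hx
  exact h1 this

/-- Every vertex starts an induced path on three vertices. -/
lemma GoodSet.path (g : GoodSet G H) {h : V} (hh : h ∈ H) :
    ∃ k ∈ H, ∃ l ∈ H, G.Adj h k ∧ G.Adj k l ∧ ¬ G.Adj h l ∧ l ≠ h := by
  by_contra hc
  push Not at hc
  have key : ∀ k ∈ H, G.Adj h k → ∀ l ∈ H, G.Adj k l → l = h := by
    intro k hk hhk l hl hkl
    by_contra hne
    exact hne (hc k hk l hl hhk hkl (fun h' => g.tri h hh k hk l hl hhk hkl h'))
  obtain ⟨k, hk, hhk⟩ := g.nbr hh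
  obtain ⟨x, hx, h1, h2, -⟩ := g.big h k k k
  have := g.conn {x | x = h ∨ G.Adj h x} ⟨h, hh, Or.inl rfl⟩ (by
    rintro x hx (rfl | hx') y hy hxy
    · exact Or.inr hxy
    · exact Or.inl (key x hx hx' y hy hxy)) x hx
  rcases this with h3 | h3
  · exact h1 h3
  · obtain ⟨z, hz, hzz⟩ := g.twin x hx k hk h2
    apply hzz
    constructor
    · intro h'
      rw [key x hx h3 z hz h']; exact hhk.symm
    · intro h'
      rw [key k hk hhk z hz h']; exact h3.symm

/-- The vertex imitated is unique. -/
lemma GoodSet.tw_unique (g : GoodSet G H) {v h h' : V} (hh : h ∈ H) (hh' : h' ∈ H)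
    (t : Tw G H v h) (t' : Tw G H v h') : h = h' := by
  by_contra hne
  have ag : ∀ x ∈ H, x ≠ h → x ≠ h' → (G.Adj h x ↔ G.Adj h' x) := fun x hx h1 h2 =>
    (t x hx h1).symm.trans (t' x hx h2)
  obtain ⟨z, hz, hzz⟩ := g.twin h hh h' hh' hne
  have hadj : G.Adj h h' := by
    by_contra hn
    have hn' : ¬ G.Adj h' h := fun h => hn h.symm
    apply hzz
    by_cases h1 : z = h
    · subst h1; simp [hn']
    · by_cases h2 : z = h'
      · subst h2; simp [hn]
      · exact ag z hz h1 h2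
  obtain ⟨k, hk, l, hl, a1, a2, a3, a4⟩ := g.path hh
  by_cases hk' : k = h'
  · subst hk'
    exact a3 ((ag l hl a4 a2.ne').2 a2)
  · exact g.tri h hh h' hh' k hk hadj ((ag k hk a1.ne' hk').1 a1) a1

/-- A vertex complete to an edge but not to everything is a true twin. -/
lemma GoodSet.true_twin (g : GoodSet G H) (hHo : FreeOf G house) (hBu : FreeOf G bull)
    {v a b : V} (ha : a ∈ H) (hb : b ∈ H) (hab : G.Adj a b) (hva : G.Adj v a) (hvb : G.Adj v b)
    (hm : ∃ m ∈ H, ¬ G.Adj v m) : ∃ h ∈ H, G.Adj v h ∧ Tw G H v h := by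
  -- key fact
  have key : ∀ h1 ∈ H, ∀ h2 ∈ H, ∀ h3 ∈ H, G.Adj h1 h2 → G.Adj h2 h3 → G.Adj v h1 →
      G.Adj v h2 → ¬ G.Adj v h3 → ∀ h4 ∈ H, G.Adj h1 h4 → G.Adj v h4 := by
    intro h1 m1 h2 m2 h3 m3 a12 a23 v1 v2 v3 h4 m4 a14
    by_contra v4
    have n13 : ¬ G.Adj h1 h3 := fun h => g.tri h1 m1 h2 m2 h3 m3 a12 a23 h
    have n24 : ¬ G.Adj h4 h2 := fun h => g.tri h1 m1 h4 m4 h2 m2 a14 h a12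
    by_cases a34 : G.Adj h3 h4
    · exact no_house hHo v h1 h2 h3 h4 a12 a23 a34 a14.symm v1 v2 n13 (fun h => n24 h.symm) v3 v4
    · exact no_bull hBu h4 h1 h2 h3 v a14.symm a12 a23 v1.symm v2.symm n24 (fun h => a34 h.symm)
        (fun h => v4 h.symm) n13 (fun h => v3 h.symm)
  -- find h1 h2 h3
  have ex : ∃ h1 ∈ H, ∃ h2 ∈ H, ∃ h3 ∈ H, G.Adj h1 h2 ∧ G.Adj h2 h3 ∧ G.Adj v h1 ∧
      G.Adj v h2 ∧ ¬ G.Adj v h3 := by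
    by_contra hc
    push Not at hc
    obtain ⟨m, hm, hvm⟩ := hm
    have := g.conn {x | G.Adj v x ∧ ∃ y ∈ H, G.Adj v y ∧ G.Adj y x}
      ⟨b, hb, hvb, a, ha, hva, hab⟩ (by
        rintro x hx ⟨h1, y, hy, h2, h3⟩ z hz hxz
        exact ⟨hc y hy x hx z hz h3 hxz h2 h1, x, hx, h1, hxz⟩) m hm
    exact hvm this.1
  obtain ⟨h1, m1, h2, m2, h3, m3, a12, a23, v1, v2, v3⟩ := ex
  have n13 : ¬ G.Adj h1 h3 := fun h => g.tri h1 m1 h2 m2 h3 m3 a12 a23 h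
  have dom : ∀ k ∈ H, G.Adj k h2 → G.Adj v k → ∀ u ∈ H, G.Adj v u →
      G.Adj u k ∨ G.Adj u h2 ∨ u = h2 := by
    intro h1 m1 a12 v1 u mu vu
    have n13 : ¬ G.Adj h1 h3 := fun h => g.tri h1 m1 h2 m2 h3 m3 a12 a23 h
    by_contra hc
    push Not at hc
    obtain ⟨c1, c2, c3⟩ := hc
    by_cases c4 : G.Adj u h3
    · exact no_house hHo h1 v h2 h3 u v2 a23 c4.symm vu.symm v1.symm a12 v3
        (fun h => c2 h.symm) n13 (fun h => c1 h.symm)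
    · exact no_bull hBu u v h2 h3 h1 vu.symm v2 a23 v1 a12.symm c2 c4 c1 v3
        (fun h => n13 h.symm)
  refine ⟨h1, m1, v1, ?_⟩
  intro x hx hne
  constructor
  · intro hvx
    rcases dom h1 m1 a12 v1 x hx hvx with h | h | h
    · exact h.symm
    · exfalso
      obtain ⟨z, hz, hzz⟩ := g.twin x hx h1 m1 hne
      apply hzz
      constructor
      · intro hxz
        have vz := key x hx h2 m2 h3 m3 h a23 hvx v2 v3 z hz hxz
        rcases dom h1 m1 a12 v1 z hz vz with h' | h' | h'
        · exact h'.symm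
        · exact (g.tri x hx z hz h2 m2 hxz h' h).elim
        · rw [h']; exact a12
      · intro hxz
        have vz := key h1 m1 h2 m2 h3 m3 a12 a23 v1 v2 v3 z hz hxz
        rcases dom x hx h hvx z hz vz with h' | h' | h'
        · exact h'.symm
        · exact (g.tri h1 m1 z hz h2 m2 hxz h' a12).elim
        · rw [h']; exact h
    · rw [h]; exact a12
  · exact fun h => key h1 m1 h2 m2 h3 m3 a12 a23 v1 v2 v3 x hx h

/-- Maximality: adding a vertex without creating triangles creates a false twin. -/
lemma MaxGood.false_twin (M : MaxGood G H) {v a : V} (hv : v ∉ H) (ha : a ∈ H) (hva : G.Adj v a)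
    (ht : ∀ x ∈ H, ∀ y ∈ H, G.Adj x y → G.Adj v x → G.Adj v y → False) :
    ∃ h ∈ H, ¬ G.Adj v h ∧ Tw G H v h := by
  classical
  obtain ⟨g, mx⟩ := M
  by_contra hc
  push Not at hc
  have : GoodSet G (insert v H) := by
    refine ⟨?_, ?_, ?_, ?_⟩
    · rw [Finset.card_insert_of_notMem hv]; have := g.card; omega
    · intro x hx y hy z hz a1 a2 a3
      rw [Finset.mem_insert] at hx hy hz
      have s1 := a1.symm
      have s2 := a2.symm
      have s3 := a3.symm
      rcases hx with rfl | hx <;> rcases hy with rfl | hy <;> rcases hz with rfl | hz <;>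
        grind [G.irrefl, g.tri]
    · have main : ∀ x ∈ H, ∃ z ∈ insert v H, ¬ (G.Adj v z ↔ G.Adj x z) := by
        intro x hx
        by_contra hcc
        push Not at hcc
        have h1 := hcc x (Finset.mem_insert_of_mem hx)
        have h2 : ¬ G.Adj v x := fun h => G.irrefl (h1.1 h)
        exact hc x hx h2 (fun y hy _ => hcc y (Finset.mem_insert_of_mem hy))
      intro x hx y hy hxy
      rw [Finset.mem_insert] at hx hy
      rcases hx with rfl | hx <;> rcases hy with rfl | hy
      · exact absurd rfl hxy
      · exact main y hy
      · obtain ⟨z, hz, h⟩ := main x hx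
        exact ⟨z, hz, fun h' => h h'.symm⟩
      · obtain ⟨z, hz, h⟩ := g.twin x hx y hy hxy
        exact ⟨z, Finset.mem_insert_of_mem hz, h⟩
    · intro S hS hcl
      have hex : ∃ x ∈ H, x ∈ S := by
        obtain ⟨x, hx, hxS⟩ := hS
        rw [Finset.mem_insert] at hx
        rcases hx with rfl | hx
        · exact ⟨a, ha, hcl _ (Finset.mem_insert_self _ _) hxS a (Finset.mem_insert_of_mem ha) hva⟩
        · exact ⟨x, hx, hxS⟩
      have hall := g.conn S hex (fun x hx hxS y hy h =>
        hcl x (Finset.mem_insert_of_mem hx) hxS y (Finset.mem_insert_of_mem hy) h)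
      intro y hy
      rw [Finset.mem_insert] at hy
      rcases hy with rfl | hy
      · exact hcl a (Finset.mem_insert_of_mem ha) (hall a ha) y (Finset.mem_insert_self _ _)
          hva.symm
      · exact hall y hy
  have := mx _ this
  rw [Finset.card_insert_of_notMem hv] at this
  omega

/-- Maximality: two vertices cannot be added at once. -/
lemma MaxGood.no_two (M : MaxGood G H) {v w a : V} (hv : v ∉ H) (hw : w ∉ H) (hvw : v ≠ w)
    (ha : a ∈ H) (hva : G.Adj v a)
    (hw' : G.Adj w v ∨ ∃ b ∈ H, G.Adj w b)
    (ht : ∀ x ∈ H, ∀ y ∈ H, G.Adj x y → G.Adj v x → G.Adj v y → False)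
    (ht' : ∀ x ∈ H, ∀ y ∈ H, G.Adj x y → G.Adj w x → G.Adj w y → False)
    (htt : G.Adj v w → ∀ x ∈ H, G.Adj v x → G.Adj w x → False)
    (tv : ∀ x ∈ H, ∃ z ∈ insert v (insert w (H : Set V)), ¬ (G.Adj v z ↔ G.Adj x z))
    (tw : ∀ x ∈ H, ∃ z ∈ insert v (insert w (H : Set V)), ¬ (G.Adj w z ↔ G.Adj x z))
    (tvw : ∃ z ∈ insert v (insert w (H : Set V)), ¬ (G.Adj v z ↔ G.Adj w z)) : False := by
  classical
  obtain ⟨g, mx⟩ := M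
  have hv' : v ∉ insert w H := by simp [hv, hvw]
  have memH : ∀ x ∈ H, x ∈ insert v (insert w H) := fun x hx =>
    Finset.mem_insert_of_mem (Finset.mem_insert_of_mem hx)
  have memv : v ∈ insert v (insert w H) := Finset.mem_insert_self _ _
  have memw : w ∈ insert v (insert w H) := Finset.mem_insert_of_mem (Finset.mem_insert_self _ _)
  have hcard : (insert v (insert w H)).card = H.card + 2 := by
    rw [Finset.card_insert_of_notMem hv', Finset.card_insert_of_notMem hw]
  have : GoodSet G (insert v (insert w H)) := by
    refine ⟨?_, ?_, ?_, ?_⟩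
    · have := g.card; omega
    · intro x hx y hy z hz a1 a2 a3
      rw [Finset.mem_insert, Finset.mem_insert] at hx hy hz
      have s1 := a1.symm
      have s2 := a2.symm
      have s3 := a3.symm
      rcases hx with rfl | rfl | hx <;> rcases hy with rfl | rfl | hy <;>
        rcases hz with rfl | rfl | hz <;>
        grind [G.irrefl, g.tri]
    · have conv : ∀ x y, (∃ z ∈ insert v (insert w (H : Set V)), ¬ (G.Adj x z ↔ G.Adj y z)) →
          (∃ z ∈ insert v (insert w H), ¬ (G.Adj x z ↔ G.Adj y z)) ∧
          (∃ z ∈ insert v (insert w H), ¬ (G.Adj y z ↔ G.Adj x z)) := by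
        rintro x y ⟨z, hz, h⟩
        have hz' : z ∈ insert v (insert w H) := by simpa using hz
        exact ⟨⟨z, hz', h⟩, ⟨z, hz', fun h' => h h'.symm⟩⟩
      intro x hx y hy hxy
      rw [Finset.mem_insert, Finset.mem_insert] at hx hy
      rcases hx with rfl | rfl | hx <;> rcases hy with rfl | rfl | hy
      · exact absurd rfl hxy
      · exact (conv _ _ tvw).1
      · exact (conv _ _ (tv y hy)).1
      · exact (conv _ _ tvw).2
      · exact absurd rfl hxy
      · exact (conv _ _ (tw y hy)).1
      · exact (conv _ _ (tv x hx)).2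
      · exact (conv _ _ (tw x hx)).2
      · obtain ⟨z, hz, h⟩ := g.twin x hx y hy hxy
        exact ⟨z, memH z hz, h⟩
    · intro S hS hcl
      have hex : ∃ x ∈ H, x ∈ S := by
        obtain ⟨x, hx, hxS⟩ := hS
        rw [Finset.mem_insert, Finset.mem_insert] at hx
        rcases hx with rfl | rfl | hx
        · exact ⟨a, ha, hcl _ memv hxS a (memH a ha) hva⟩
        · rcases hw' with h | ⟨b, hb, h⟩
          · exact ⟨a, ha, hcl _ memv (hcl _ memw hxS _ memv h) a (memH a ha) hva⟩
          · exact ⟨b, hb, hcl _ memw hxS b (memH b hb) h⟩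
        · exact ⟨x, hx, hxS⟩
      have hall := g.conn S hex (fun x hx hxS y hy h =>
        hcl x (memH x hx) hxS y (memH y hy) h)
      have hvS : v ∈ S := hcl a (memH a ha) (hall a ha) v memv hva.symm
      intro y hy
      rw [Finset.mem_insert, Finset.mem_insert] at hy
      rcases hy with rfl | rfl | hy
      · exact hvS
      · rcases hw' with h | ⟨b, hb, h⟩
        · exact hcl v memv hvS y memw h.symm
        · exact hcl b (memH b hb) (hall b hb) y memw h.symm
      · exact hall y hy
  have := mx _ this
  omega

/-- A false twin sees exactly the same vertices of `H`. -/
lemma tw_full {t h : V} (tw : Tw G H t h) (hn : ¬ G.Adj t h) :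
    ∀ x ∈ H, (G.Adj t x ↔ G.Adj h x) := by
  intro x hx
  by_cases e : x = h
  · subst e; simp [hn]
  · exact tw x hx e

/-- Vertices anticomplete to `H` are anticomplete to twins. -/
lemma MaxGood.anti (M : MaxGood G H) (hBu : FreeOf G bull) {n t h : V} (hh : h ∈ H)
    (tw : Tw G H t h) (hn : ∀ x ∈ H, ¬ G.Adj n x) : ¬ G.Adj n t := by
  intro hnt
  have g := M.1
  obtain ⟨k, hk, l, hl, a1, a2, a3, a4⟩ := g.path hh
  have tk : G.Adj t k := (tw k hk a1.ne').2 a1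
  have tl : ¬ G.Adj t l := fun h => a3 ((tw l hl a4).1 h)
  by_cases hth : G.Adj t h
  · exact no_bull hBu n t k l h hnt tk a2 hth a1.symm (hn k hk) (hn l hl) (hn h hh) tl
      (fun h => a3 h.symm)
  · have full := tw_full tw hth
    have htH : t ∉ H := fun ht => hn t ht hnt
    have hnH : n ∉ H := by
      intro hnH
      obtain ⟨z, hz, h⟩ := g.nbr hnH
      exact hn z hz h
    refine M.no_two htH hnH hnt.ne' hk tk (Or.inl hnt) ?_ ?_ ?_ ?_ ?_ ?_
    · intro x hx y hy hxy h1 h2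
      exact g.tri h hh x hx y hy ((full x hx).1 h1) hxy ((full y hy).1 h2)
    · intro x hx y hy hxy h1 h2
      exact hn x hx h1
    · intro _ x hx _ h2
      exact hn x hx h2
    · intro x hx
      refine ⟨n, by simp, fun h => hn x hx (h.1 hnt.symm).symm⟩
    · intro x hx
      obtain ⟨z, hz, h⟩ := g.nbr hx
      exact ⟨z, by simp [hz], fun h' => hn z hz (h'.2 h)⟩
    · exact ⟨k, by simp [hk], fun e => hn k hk (e.1 tk)⟩

/-- Vertices complete to `H` are complete to twins. -/
lemma GoodSet.compl (g : GoodSet G H) (hHo : FreeOf G house) (hBu : FreeOf G bull)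
    {b t h : V} (hh : h ∈ H)
    (tw : Tw G H t h) (hb : ∀ x ∈ H, G.Adj b x) : G.Adj b t := by
  by_contra hbt
  have dom : ∀ k ∈ H, ∀ l ∈ H, G.Adj h k → G.Adj k l → l ≠ h → ∀ m ∈ H,
      G.Adj m h ∨ G.Adj m k ∨ G.Adj m l ∨ m = h := by
    intro k hk l hl a1 a2 a3 m hm
    by_contra hc
    push Not at hc
    obtain ⟨c1, c2, c3, c4⟩ := hc
    have n1 : ¬ G.Adj h l := fun h' => g.tri h hh k hk l hl a1 a2 h'
    refine no_bull hBu t k b m l ((tw k hk a1.ne').2 a1) (hb k hk).symm (hb m hm) a2 (hb l hl)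
      (fun h => hbt h.symm) (fun h' => c1 ((tw m hm c4).1 h').symm)
      (fun h' => n1 ((tw l hl a3).1 h')) (fun h => c2 h.symm) c3
  have uk : ∀ k ∈ H, ∀ k' ∈ H, G.Adj h k → G.Adj h k' → ∀ l ∈ H, G.Adj k l → G.Adj k' l := by
    intro k hk k' hk' a1 a2 l hl a3
    by_cases e : l = h
    · subst e; exact a2.symm
    by_contra hc
    have n1 : ¬ G.Adj h l := fun h' => g.tri h hh k hk l hl a1 a3 h'
    have n2 : ¬ G.Adj k k' := fun h' => g.tri h hh k hk k' hk' a1 h' a2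
    exact no_house hHo l k b k' t (hb k hk).symm (hb k' hk') ((tw k' hk' a2.ne').2 a2).symm
      ((tw k hk a1.ne').2 a1) a3.symm (hb l hl).symm n2 hbt (fun h => hc h.symm)
      (fun h' => n1 ((tw l hl e).1 h'.symm))
  obtain ⟨k, hk, l, hl, a1, a2, a3, a4⟩ := g.path hh
  have k1 : ∀ k' ∈ H, G.Adj h k' → k' = k := by
    intro k' hk' a
    by_contra hne
    obtain ⟨z, hz, hzz⟩ := g.twin k' hk' k hk hne
    exact hzz ⟨uk k' hk' k hk a a1 z hz, uk k hk k' hk' a1 a z hz⟩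
  have l1 : ∀ l' ∈ H, G.Adj k l' → l' ≠ h → l' = l := by
    intro l' hl' a b'
    by_contra hne
    obtain ⟨z, hz, hzz⟩ := g.twin l' hl' l hl hne
    have half : ∀ p ∈ H, ∀ q ∈ H, G.Adj k p → G.Adj k q → q ≠ h → G.Adj p z → G.Adj q z := by
      intro p hp q hq c1 c2 c3 c4
      rcases dom k hk q hq a1 c2 c3 z hz with d | d | d | d
      · rw [k1 z hz d.symm]; exact c2.symm
      · exact (g.tri k hk p hp z hz c1 c4 d.symm).elim
      · exact d.symm
      · subst d
        exact (g.tri k hk p hp z hz c1 c4 a1.symm).elim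
    exact hzz ⟨half l' hl' l hl a a2 a4, half l hl l' hl' a2 a b'⟩
  have m1 : ∀ m ∈ H, m ≠ h → m ≠ k → m ≠ l → G.Adj m l := by
    intro m hm c1 c2 c3
    rcases dom k hk l hl a1 a2 a4 m hm with d | d | d | d
    · exact (c2 (k1 m hm d.symm)).elim
    · exact (c3 (l1 m hm d.symm c1)).elim
    · exact d
    · exact (c1 d).elim
  have m2 : ∀ m ∈ H, m ≠ h → m ≠ k → m ≠ l → ∀ z ∈ H, G.Adj m z → z = l := by
    intro m hm c1 c2 c3 z hz a
    by_contra hne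
    by_cases e1 : z = h
    · subst e1; exact c2 (k1 m hm a.symm)
    by_cases e2 : z = k
    · subst e2; exact c3 (l1 m hm a.symm c1)
    exact g.tri m hm z hz l hl a (m1 z hz e1 e2 hne) (m1 m hm c1 c2 c3)
  obtain ⟨m, hm, c1, c2, c3, -⟩ := g.big h k l l
  obtain ⟨p, hp, d1, d2, d3, d4⟩ := g.big h k l m
  obtain ⟨z, hz, hzz⟩ := g.twin p hp m hm d4
  apply hzz
  constructor
  · intro a
    rw [m2 p hp d1 d2 d3 z hz a]; exact m1 m hm c1 c2 c3
  · intro a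
    rw [m2 m hm c1 c2 c3 z hz a]; exact m1 p hp d1 d2 d3

/-- Two false twins behave like the originals if there is no common neighbour trouble. -/
lemma MaxGood.two_false (M : MaxGood G H) {t t' h h' : V} (hh : h ∈ H) (hh' : h' ∈ H)
    (hne : h ≠ h') (tw : Tw G H t h) (tw' : Tw G H t' h') (ht : t ∉ H) (ht' : t' ∉ H)
    (n : ¬ G.Adj t h) (n' : ¬ G.Adj t' h')
    (bad : ¬ (G.Adj t t' ↔ G.Adj h h'))
    (noc : G.Adj t t' → ∀ y ∈ H, G.Adj h y → G.Adj h' y → False) : False := by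
  have g := M.1
  have f := tw_full tw n
  have f' := tw_full tw' n'
  obtain ⟨a, ha, haa⟩ := g.nbr hh
  obtain ⟨b, hb, hbb⟩ := g.nbr hh'
  obtain ⟨z, hz, hzz⟩ := g.twin h hh h' hh' hne
  have hdiff : ¬ (G.Adj t z ↔ G.Adj t' z) := by rw [f z hz, f' z hz]; exact hzz
  have bad1 : ¬ (G.Adj t t' ↔ G.Adj h t') := by
    rw [G.adj_comm h t', f' h hh, G.adj_comm h' h]; exact bad
  have bad2 : ¬ (G.Adj t' t ↔ G.Adj h' t) := by
    rw [G.adj_comm h' t, f h' hh', G.adj_comm t' t]; exact bad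
  refine M.no_two ht ht' (by rintro rfl; exact hdiff Iff.rfl) ha ((f a ha).2 haa)
    (Or.inr ⟨b, hb, (f' b hb).2 hbb⟩) ?_ ?_ ?_ ?_ ?_ ?_
  · intro x hx y hy hxy h1 h2
    exact g.tri h hh x hx y hy ((f x hx).1 h1) hxy ((f y hy).1 h2)
  · intro x hx y hy hxy h1 h2
    exact g.tri h' hh' x hx y hy ((f' x hx).1 h1) hxy ((f' y hy).1 h2)
  · intro e x hx h1 h2
    exact noc e x hx ((f x hx).1 h1) ((f' x hx).1 h2)
  · intro x hx
    by_cases e : x = h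
    · subst e; exact ⟨t', by simp, bad1⟩
    · obtain ⟨w, hw, hww⟩ := g.twin h hh x hx (Ne.symm e)
      exact ⟨w, by simp [hw], by rw [f w hw]; exact hww⟩
  · intro x hx
    by_cases e : x = h'
    · subst e; exact ⟨t, by simp, bad2⟩
    · obtain ⟨w, hw, hww⟩ := g.twin h' hh' x hx (Ne.symm e)
      exact ⟨w, by simp [hw], by rw [f' w hw]; exact hww⟩
  · exact ⟨z, by simp [hz], hdiff⟩

/-- Adjacent originals, first twin true: the twins are adjacent. -/
lemma GoodSet.adj_case (g : GoodSet G H) (hHo : FreeOf G house) (hBu : FreeOf G bull)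
    {t t' h h' : V} (hh : h ∈ H) (hh' : h' ∈ H)
    (tw : Tw G H t h) (tw' : Tw G H t' h')
    (a : G.Adj h h') (th : G.Adj t h) : G.Adj t t' := by
  by_contra ntt
  have ntt' : ¬ G.Adj t' t := fun h => ntt h.symm
  have th' : G.Adj t h' := (tw h' hh' a.ne').2 a
  have sh : G.Adj t' h := (tw' h hh a.ne).2 a.symm
  -- no continuation beyond distance two on the side of h
  have s1 : ∀ m ∈ H, G.Adj h m → m ≠ h' → ∀ l ∈ H, G.Adj m l → l ≠ h → l ≠ h' → G.Adj h' l := by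
    intro m hm a1 c1 l hl a2 c2 c3
    by_contra hc
    have n1 : ¬ G.Adj h l := fun h' => g.tri h hh m hm l hl a1 a2 h'
    have n2 : ¬ G.Adj h' m := fun e => g.tri h hh h' hh' m hm a e a1
    exact no_bull hBu t' h m l t sh a1 a2 th.symm ((tw m hm a1.ne').2 a1).symm
      (fun e => n2 ((tw' m hm c1).1 e)) (fun e => hc ((tw' l hl c3).1 e)) ntt' n1
      (fun e => n1 ((tw l hl c2).1 e.symm))
  by_cases hk : ∃ k ∈ H, G.Adj h' k ∧ k ≠ h
  · obtain ⟨k, hk, b1, b2⟩ := hk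
    have nhk : ¬ G.Adj h k := fun e => g.tri h hh h' hh' k hk a b1 e
    have tk : ¬ G.Adj t k := fun e => nhk ((tw k hk b2).1 e)
    have sk : G.Adj t' k := (tw' k hk b1.ne').2 b1
    by_cases e : G.Adj t' h'
    · have s2 : ∀ m ∈ H, G.Adj h m → m ≠ h' → ∀ k ∈ H, G.Adj h' k → k ≠ h → ¬ G.Adj m k := by
        intro m hm a1 c1 k hk b1 b2 c
        have nhk : ¬ G.Adj h k := fun e => g.tri h hh h' hh' k hk a b1 e
        have tk : ¬ G.Adj t k := fun e => nhk ((tw k hk b2).1 e)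
        have sk : G.Adj t' k := (tw' k hk b1.ne').2 b1
        have n2 : ¬ G.Adj h' m := fun e => g.tri h hh h' hh' m hm a e a1
        have sm : ¬ G.Adj t' m := fun e => n2 ((tw' m hm c1).1 e)
        exact no_house hHo t m h t' k a1.symm sh.symm sk c.symm ((tw m hm a1.ne').2 a1) th
          (fun e => sm e.symm) nhk ntt tk
      have s3 : ∀ m ∈ H, G.Adj h m → m ≠ h' → ∀ l ∈ H, G.Adj m l → l = h := by
        intro m hm a1 c1 l hl a2
        by_contra c2
        by_cases c3 : l = h'
        · subst c3; exact g.tri h hh m hm l hl a1 a2 a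
        · exact s2 m hm a1 c1 l hl (s1 m hm a1 c1 l hl a2 c2 c3) c2 a2
      have s1' : ∀ k ∈ H, G.Adj h' k → k ≠ h → ∀ l ∈ H, G.Adj k l → l = h' := by
        intro k hk b1 b2 l hl b3
        by_contra c2
        have nhk : ¬ G.Adj h k := fun e => g.tri h hh h' hh' k hk a b1 e
        have tk : ¬ G.Adj t k := fun e => nhk ((tw k hk b2).1 e)
        have sk : G.Adj t' k := (tw' k hk b1.ne').2 b1
        have c3 : l ≠ h := by rintro rfl; exact nhk b3.symm
        have n1 : ¬ G.Adj h' l := fun e => g.tri h' hh' k hk l hl b1 b3 e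
        by_cases hl' : G.Adj h l
        · exact s2 l hl hl' c2 k hk b1 b2 b3.symm
        · exact no_bull hBu t h' k l t' th' b1 b3 e.symm sk.symm tk
            (fun e => hl' ((tw l hl c3).1 e)) ntt n1 (fun e => n1 ((tw' l hl c2).1 e.symm))
      -- all vertices
      have all := g.conn {x | x = h ∨ x = h' ∨ G.Adj h x ∨ G.Adj h' x} ⟨h, hh, Or.inl rfl⟩ (by
        rintro x hx hxS y hy hxy
        by_cases e1 : x = h
        · subst e1; exact Or.inr (Or.inr (Or.inl hxy))
        by_cases e2 : x = h'
        · subst e2; exact Or.inr (Or.inr (Or.inr hxy))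
        rcases hxS with c | c | c | c
        · exact absurd c e1
        · exact absurd c e2
        · exact Or.inl (s3 x hx c e2 y hy hxy)
        · exact Or.inr (Or.inl (s1' x hx c e1 y hy hxy)))
      have um : ∀ m ∈ H, ∀ p ∈ H, G.Adj h m → m ≠ h' → G.Adj h p → p ≠ h' → m = p := by
        intro m hm p hp c1 c2 c3 c4
        by_contra hne
        obtain ⟨z, hz, hzz⟩ := g.twin m hm p hp hne
        apply hzz
        constructor
        · intro c
          rw [s3 m hm c1 c2 z hz c]; exact c3.symm
        · intro c
          rw [s3 p hp c3 c4 z hz c]; exact c1.symm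
      have uk : ∀ m ∈ H, ∀ p ∈ H, G.Adj h' m → m ≠ h → G.Adj h' p → p ≠ h → m = p := by
        intro m hm p hp c1 c2 c3 c4
        by_contra hne
        obtain ⟨z, hz, hzz⟩ := g.twin m hm p hp hne
        apply hzz
        constructor
        · intro c
          rw [s1' m hm c1 c2 z hz c]; exact c3.symm
        · intro c
          rw [s1' p hp c3 c4 z hz c]; exact c1.symm
      have rest : ∀ x ∈ H, x ≠ h → x ≠ h' → x ≠ k → G.Adj h x := by
        intro x hx d1 d2 d3
        rcases all x hx with c | c | c | c
        · exact absurd c d1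
        · exact absurd c d2
        · exact c
        · exact absurd (uk x hx k hk c d1 b1 b2) d3
      obtain ⟨m, hm, d1, d2, d3, -⟩ := g.big h h' k k
      obtain ⟨p, hp, f1, f2, f3, f4⟩ := g.big h h' k m
      exact f4 (um p hp m hm (rest p hp f1 f2 f3) f2 (rest m hm d1 d2 d3) d2)
    · exact no_house hHo t h h' k t' a b1 sk.symm sh th th' nhk (fun c => e c.symm) tk ntt
  · push Not at hk
    have : ∀ y ∈ H, G.Adj h y ∨ y = h := by
      apply g.conn {x | G.Adj h x ∨ x = h} ⟨h, hh, Or.inr rfl⟩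
      intro x hx hxS y hy hxy
      by_contra hc
      simp only [Set.mem_ofPred_eq, not_or] at hc hxS
      rcases hxS with c | c
      · by_cases e : x = h'
        · subst e; exact hc.2 (hk y hy hxy)
        · by_cases e' : y = h'
          · subst e'; exact hc.1 a
          · exact hc.2 (hk y hy (s1 x hx c e y hy hxy hc.2 e'))
      · subst c; exact hc.1 hxy
    obtain ⟨k, hk, l, hl, a1, a2, a3, a4⟩ := g.path hh
    rcases this l hl with c | c
    · exact a3 c
    · exact a4 c

/-- Nonadjacent originals with a private neighbour of `h` and a common neighbour. -/
lemma GoodSet.common_case (g : GoodSet G H) (hHo : FreeOf G house) (hBu : FreeOf G bull)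
    {t t' h h' y z : V} (hh : h ∈ H) (hh' : h' ∈ H) (hne : h ≠ h')
    (tw : Tw G H t h) (tw' : Tw G H t' h')
    (n : ¬ G.Adj h h') (hy : y ∈ H) (hz : z ∈ H) (y1 : G.Adj h y) (y2 : G.Adj h' y)
    (z1 : G.Adj h z) (z2 : ¬ G.Adj h' z) : ¬ G.Adj t t' := by
  intro tt
  have th' : ¬ G.Adj t h' := fun e => n ((tw h' hh' hne.symm).1 e)
  have sh : ¬ G.Adj t' h := fun e => n ((tw' h hh hne).1 e).symm
  have ty : G.Adj t y := (tw y hy y1.ne').2 y1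
  have sy : G.Adj t' y := (tw' y hy y2.ne').2 y2
  have zh' : z ≠ h' := by rintro rfl; exact n z1
  have tz : G.Adj t z := (tw z hz z1.ne').2 z1
  have sz : ¬ G.Adj t' z := fun e => z2 ((tw' z hz zh').1 e)
  have zy : ¬ G.Adj z y := fun e => g.tri h hh z hz y hy z1 e y1
  have e' : G.Adj t' h' := by
    by_contra e
    exact no_bull hBu z t y h' t' tz.symm ty y2.symm tt sy.symm zy (fun c => z2 c.symm)
      (fun c => sz c.symm) th' (fun c => e c.symm)
  have e : G.Adj t h := by
    by_contra e
    exact no_house hHo t' t y h z ty y1.symm z1 tz.symm tt.symm sy e (fun c => zy c.symm) sh sz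
  have leaf : ∀ w ∈ H, G.Adj z w → w = h := by
    intro w hw a
    by_contra c
    have hw1 : ¬ G.Adj h w := fun e => g.tri h hh z hz w hw z1 a e
    have tw1 : ¬ G.Adj t w := fun e => hw1 ((tw w hw c).1 e)
    have c' : w ≠ h' := by rintro rfl; exact z2 a.symm
    by_cases d : G.Adj h' w
    · exact no_house hHo h z t t' w tz.symm tt ((tw' w hw c').2 d) a.symm z1 e.symm
        (fun c => sz c.symm) tw1 (fun c => sh c.symm) hw1
    · exact no_bull hBu w z t t' h a.symm tz.symm tt z1.symm e (fun c => tw1 c.symm)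
        (fun c' => d ((tw' w hw (by assumption)).1 c'.symm)) (fun c => hw1 c.symm)
        (fun c => sz c.symm) sh
  -- neighbours of a common neighbour
  have yn : ∀ y ∈ H, G.Adj h y → G.Adj h' y → ∀ q ∈ H, G.Adj y q → q = h ∨ q = h' := by
    intro y hy y1 y2 q hq a
    by_contra c
    push Not at c
    have ty : G.Adj t y := (tw y hy y1.ne').2 y1
    have sy : G.Adj t' y := (tw' y hy y2.ne').2 y2
    have zy : ¬ G.Adj z y := fun e => g.tri h hh z hz y hy z1 e y1
    have q1 : ¬ G.Adj h q := fun e => g.tri h hh y hy q hq y1 a e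
    have q2 : ¬ G.Adj h' q := fun e => g.tri h' hh' y hy q hq y2 a e
    exact no_bull hBu z t y q t' tz.symm ty a tt sy.symm zy (fun e => c.1 (leaf q hq e))
      (fun c => sz c.symm) (fun e => q1 ((tw q hq c.1).1 e))
      (fun e => q2 ((tw' q hq c.2).1 e.symm))
  -- neighbours of the second original are common
  have nh' : ∀ q ∈ H, G.Adj h' q → G.Adj h q := by
    intro q hq a
    by_contra c
    have qh : q ≠ h := by rintro rfl; exact n a.symm
    have sq : G.Adj t' q := (tw' q hq a.ne').2 a
    have tq : ¬ G.Adj t q := fun e => c ((tw q hq qh).1 e)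
    have qy : ¬ G.Adj y q := fun e => g.tri h' hh' y hy q hq y2 e a
    refine no_bull hBu z t t' q y tz.symm tt sq ty sy (fun c => sz c.symm)
      (fun e => qh (leaf q hq e)) zy tq (fun c => qy c.symm)
  have nz : ∀ z' ∈ H, G.Adj h z' → ¬ G.Adj h' z' → ∀ w ∈ H, G.Adj z' w → w = h := by
    intro z hz z1 z2 w hw a
    by_contra c
    have zh' : z ≠ h' := by rintro rfl; exact n z1
    have tz : G.Adj t z := (tw z hz z1.ne').2 z1
    have sz : ¬ G.Adj t' z := fun e => z2 ((tw' z hz zh').1 e)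
    have hw1 : ¬ G.Adj h w := fun e => g.tri h hh z hz w hw z1 a e
    have tw1 : ¬ G.Adj t w := fun e => hw1 ((tw w hw c).1 e)
    have c' : w ≠ h' := by rintro rfl; exact z2 a.symm
    have d : ¬ G.Adj h' w := fun d => hw1 (nh' w hw d)
    exact no_bull hBu w z t t' h a.symm tz.symm tt z1.symm e (fun c => tw1 c.symm)
        (fun c'' => d ((tw' w hw c').1 c''.symm)) (fun c => hw1 c.symm)
        (fun c => sz c.symm) sh
  have all := g.conn {x | x = h ∨ x = h' ∨ G.Adj h x} ⟨h, hh, Or.inl rfl⟩ (by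
    rintro x hx hxS w hw hxw
    rcases hxS with c | c | c
    · subst c; exact Or.inr (Or.inr hxw)
    · subst c; exact Or.inr (Or.inr (nh' w hw hxw))
    · by_cases d : G.Adj h' x
      · rcases yn x hx c d w hw hxw with r | r
        · exact Or.inl r
        · exact Or.inr (Or.inl r)
      · exact Or.inl (nz x hx c d w hw hxw))
  obtain ⟨q, hq, d1, d2, d3, d4⟩ := g.big h h' y z
  have hq' : G.Adj h q := by
    rcases all q hq with c | c | c
    · exact absurd c d1
    · exact absurd c d2
    · exact c
  by_cases d : G.Adj h' q
  · obtain ⟨w, hw, hww⟩ := g.twin q hq y hy d3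
    apply hww
    constructor
    · intro c
      rcases yn q hq hq' d w hw c with r | r
      · rw [r]; exact y1.symm
      · rw [r]; exact y2.symm
    · intro c
      rcases yn y hy y1 y2 w hw c with r | r
      · rw [r]; exact hq'.symm
      · rw [r]; exact d.symm
  · obtain ⟨w, hw, hww⟩ := g.twin q hq z hz d4
    apply hww
    constructor
    · intro c
      rw [nz q hq hq' d w hw c]; exact z1.symm
    · intro c
      rw [leaf w hw c, G.adj_comm]
      assumption

/-- Nonadjacent originals without common neighbours, first twin true. -/
lemma GoodSet.far_case (g : GoodSet G H) (hHo : FreeOf G house) (hBu : FreeOf G bull)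
    {t t' h h' : V} (hh : h ∈ H) (hh' : h' ∈ H) (hne : h ≠ h')
    (tw : Tw G H t h) (tw' : Tw G H t' h')
    (n : ¬ G.Adj h h') (noc : ∀ y ∈ H, G.Adj h y → G.Adj h' y → False) (th : G.Adj t h) :
    ¬ G.Adj t t' := by
  intro tt
  have sh : ¬ G.Adj t' h := fun e => n ((tw' h hh hne).1 e).symm
  obtain ⟨k, hk, l, hl, a1, a2, a3, a4⟩ := g.path hh
  have tk : G.Adj t k := (tw k hk a1.ne').2 a1
  have tl : ¬ G.Adj t l := fun e => a3 ((tw l hl a4).1 e)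
  have kh' : k ≠ h' := by rintro rfl; exact n a1
  have sk : ¬ G.Adj t' k := fun e => noc k hk a1 ((tw' k hk kh').1 e)
  have lh' : l ≠ h' := by rintro rfl; exact noc k hk a1 a2.symm
  by_cases c : G.Adj t' l
  · exact no_house hHo h t k l t' tk a2 c.symm tt.symm th.symm a1 tl (fun e => sk e.symm) a3
      (fun e => sh e.symm)
  · exact no_bull hBu t' t k l h tt.symm tk a2 th a1.symm sk c sh tl (fun e => a3 e.symm)

/-- Twins of different vertices are related like these vertices. -/
lemma MaxGood.twins (M : MaxGood G H) (hHo : FreeOf G house) (hBu : FreeOf G bull)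
    {t t' h h' : V} (hh : h ∈ H) (hh' : h' ∈ H) (hne : h ≠ h')
    (tw : Tw G H t h) (tw' : Tw G H t' h') : G.Adj t t' ↔ G.Adj h h' := by
  have g := M.1
  by_cases ht : t ∈ H
  · have : t = h := g.tw_unique (v := t) ht hh (fun _ _ _ => Iff.rfl) tw
    subst this
    rw [G.adj_comm t t', tw' t ht hne, G.adj_comm]
  by_cases ht' : t' ∈ H
  · have : t' = h' := g.tw_unique (v := t') ht' hh' (fun _ _ _ => Iff.rfl) tw'
    subst this
    exact tw t' ht' hne.symm
  by_cases a : G.Adj h h'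
  · simp only [a, iff_true]
    by_cases th : G.Adj t h
    · exact g.adj_case hHo hBu hh hh' tw tw' a th
    by_cases th' : G.Adj t' h'
    · exact (g.adj_case hHo hBu hh' hh tw' tw a.symm th').symm
    by_contra c
    exact M.two_false hh hh' hne tw tw' ht ht' th th' (by simp [a, c]) (fun e => absurd e c)
  · simp only [a, iff_false]
    have a' : ¬ G.Adj h' h := fun e => a e.symm
    by_cases com : ∃ y ∈ H, G.Adj h y ∧ G.Adj h' y
    · obtain ⟨y, hy, y1, y2⟩ := com
      obtain ⟨z, hz, hzz⟩ := g.twin h hh h' hh' hne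
      by_cases z1 : G.Adj h z
      · have z2 : ¬ G.Adj h' z := fun e => hzz ⟨fun _ => e, fun _ => z1⟩
        exact g.common_case hHo hBu hh hh' hne tw tw' a hy hz y1 y2 z1 z2
      · have z2 : G.Adj h' z := by
          by_contra e
          exact hzz ⟨fun c => absurd c z1, fun c => absurd c e⟩
        intro c
        exact g.common_case hHo hBu hh' hh hne.symm tw' tw a' hy hz y2 y1 z2 z1 c.symm
    · have noc : ∀ y ∈ H, G.Adj h y → G.Adj h' y → False := fun y hy e e' => com ⟨y, hy, e, e'⟩
      by_cases th : G.Adj t h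
      · exact g.far_case hHo hBu hh hh' hne tw tw' a noc th
      by_cases th' : G.Adj t' h'
      · intro c
        exact g.far_case hHo hBu hh' hh hne.symm tw' tw a' (fun y hy e e' => noc y hy e' e) th'
          c.symm
      intro c
      exact M.two_false hh hh' hne tw tw' ht ht' th th' (by simp [a, c]) (fun _ => noc)

/-- Every vertex is anticomplete, complete, or a twin. -/
lemma MaxGood.types (M : MaxGood G H) (hHo : FreeOf G house) (hBu : FreeOf G bull) (v : V) :
    (∃ h ∈ H, Tw G H v h) ∨ (∀ x ∈ H, G.Adj v x) ∨ (∀ x ∈ H, ¬ G.Adj v x) := by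
  by_cases hv : v ∈ H
  · exact Or.inl ⟨v, hv, fun _ _ _ => Iff.rfl⟩
  by_cases h1 : ∀ x ∈ H, G.Adj v x
  · exact Or.inr (Or.inl h1)
  by_cases h2 : ∀ x ∈ H, ¬ G.Adj v x
  · exact Or.inr (Or.inr h2)
  left
  push Not at h1 h2
  by_cases h3 : ∃ x ∈ H, ∃ y ∈ H, G.Adj x y ∧ G.Adj v x ∧ G.Adj v y
  · obtain ⟨x, hx, y, hy, a1, a2, a3⟩ := h3
    obtain ⟨h, hh, -, e⟩ := M.1.true_twin hHo hBu hx hy a1 a2 a3 h1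
    exact ⟨h, hh, e⟩
  · obtain ⟨a, ha, hva⟩ := h2
    obtain ⟨h, hh, -, e⟩ := M.false_twin hv ha hva
      (fun x hx y hy c1 c2 c3 => h3 ⟨x, hx, y, hy, c1, c2, c3⟩)
    exact ⟨h, hh, e⟩

end

/-- Good sets from embedded five-vertex graphs. -/
lemma good_of_emb {V : Type*} {G : SimpleGraph V} {F : SimpleGraph (Fin 5)}
    (ft : ∀ x y z, F.Adj x y → F.Adj y z → F.Adj x z → False)
    (ftw : ∀ x y, x ≠ y → ∃ z, ¬ (F.Adj x z ↔ F.Adj y z))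
    (f01 : F.Adj 0 1) (f12 : F.Adj 1 2) (f23 : F.Adj 2 3) (f34 : F.Adj 3 4)
    (h : ¬ FreeOf G F) : ∃ H, GoodSet G H := by
  classical
  simp only [FreeOf, not_not] at h
  obtain ⟨f, hf⟩ := h
  refine ⟨Finset.univ.map f, ?_, ?_, ?_, ?_⟩
  · simp
  · intro x hx y hy z hz
    simp only [Finset.mem_map, Finset.mem_univ, true_and] at hx hy hz
    obtain ⟨i, rfl⟩ := hx
    obtain ⟨j, rfl⟩ := hy
    obtain ⟨k, rfl⟩ := hz
    rw [hf, hf, hf]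
    exact ft i j k
  · intro x hx y hy hxy
    simp only [Finset.mem_map, Finset.mem_univ, true_and] at hx hy
    obtain ⟨i, rfl⟩ := hx
    obtain ⟨j, rfl⟩ := hy
    obtain ⟨k, hk⟩ := ftw i j (by rintro rfl; exact hxy rfl)
    exact ⟨f k, by simp, by rw [hf, hf]; exact hk⟩
  · intro S hS hcl
    have step : ∀ i j, F.Adj i j → (f i ∈ S ↔ f j ∈ S) := fun i j hij =>
      ⟨fun h => hcl _ (by simp) h _ (by simp) ((hf i j).2 hij),
       fun h => hcl _ (by simp) h _ (by simp) ((hf j i).2 hij.symm)⟩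
    have s1 := step _ _ f01
    have s2 := step _ _ f12
    have s3 := step _ _ f23
    have s4 := step _ _ f34
    have all : ∀ i, (f i ∈ S ↔ f 0 ∈ S) := by
      intro i
      fin_cases i <;> simp <;> tauto
    obtain ⟨x, hx, hxS⟩ := hS
    simp only [Finset.mem_map, Finset.mem_univ, true_and] at hx
    obtain ⟨i, rfl⟩ := hx
    intro y hy
    simp only [Finset.mem_map, Finset.mem_univ, true_and] at hy
    obtain ⟨j, rfl⟩ := hy
    exact (all j).2 ((all i).1 hxS)

/-- Let `G` be any (house, bull)-free graph. Then either `G` has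
a proper homogeneous set that is not a stable set, or `G` is `C₅`-free and
`P₅`-free, or `G` is triangle-free. -/
theorem stmt0 {V : Type*} [Fintype V] (G : SimpleGraph V)
    (hHouse : FreeOf G house) (hBull : FreeOf G bull) :
    (∃ S : Set V, IsProperHomogSet G S ∧ ¬ IsStableSet G S) ∨
    (FreeOf G (SimpleGraph.cycleGraph 5) ∧ FreeOf G (SimpleGraph.pathGraph 5)) ∨
    G.CliqueFree 3 := by
  classical
  by_contra hcon
  push Not at hcon
  obtain ⟨hst, hF, htri⟩ := hcon
  have ex : ∃ H, GoodSet G H := by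
    by_cases hC : FreeOf G (SimpleGraph.cycleGraph 5)
    · refine good_of_emb ?_ ?_ ?_ ?_ ?_ ?_ (hF hC) <;>
        simp only [SimpleGraph.pathGraph_adj] <;> decide
    · refine good_of_emb ?_ ?_ ?_ ?_ ?_ ?_ hC <;>
        simp only [SimpleGraph.cycleGraph_adj] <;> decide
  obtain ⟨H, M⟩ : ∃ H, MaxGood G H := by
    obtain ⟨H, hH, hm⟩ := Finset.exists_max_image
      (Finset.univ.filter (fun H : Finset V => GoodSet G H)) Finset.card
      (by obtain ⟨H, hH⟩ := ex; exact ⟨H, by simp [hH]⟩)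
    exact ⟨H, by simpa using hH, fun H' h' => hm H' (by simp [h'])⟩
  have g := M.1
  -- every vertex is a twin
  have allT : ∀ v, ∃ h ∈ H, Tw G H v h := by
    by_contra hc
    obtain ⟨x, hx⟩ : H.Nonempty := Finset.card_pos.1 (by have := g.card; omega)
    obtain ⟨y, hy, hxy⟩ := g.nbr hx
    have hself : ∀ z ∈ H, ∃ h ∈ H, Tw G H z h := fun z hz => ⟨z, hz, fun _ _ _ => Iff.rfl⟩
    have := hst {v | ∃ h ∈ H, Tw G H v h} ⟨?_, ⟨x, hself x hx, y, hself y hy, hxy.ne⟩, ?_⟩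
    · exact this (hself x hx) (hself y hy) hxy.ne hxy
    · intro v hv
      rcases M.types hHouse hBull v with h | h | h
      · exact absurd h hv
      · left
        rintro s ⟨k, hk, hs⟩
        exact g.compl hHouse hBull hk hs h
      · right
        rintro s ⟨k, hk, hs⟩
        exact M.anti hBull hk hs h
    · intro e
      exact hc (fun v => by
        have : v ∈ {v | ∃ h ∈ H, Tw G H v h} := by rw [e]; trivial
        exact this)
  -- every class is stable
  have stab : ∀ h ∈ H, ∀ u v, Tw G H u h → Tw G H v h → ¬ G.Adj u v := by
    intro h hh u v hu hv huv
    have := hst {v | Tw G H v h} ⟨?_, ⟨u, hu, v, hv, huv.ne⟩, ?_⟩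
    · exact this hu hv huv.ne huv
    · intro w hw
      obtain ⟨k, hk, hwk⟩ := allT w
      have hne : k ≠ h := by rintro rfl; exact hw hwk
      by_cases c : G.Adj k h
      · exact Or.inl fun s hs => (M.twins hHouse hBull hk hh hne hwk hs).2 c
      · exact Or.inr fun s hs e => c ((M.twins hHouse hBull hk hh hne hwk hs).1 e)
    · intro e
      obtain ⟨x, hx, hxh, -⟩ := g.big h h h h
      have : x ∈ {v | Tw G H v h} := by rw [e]; trivial
      exact hxh (g.tw_unique (v := x) hx hh (fun _ _ _ => Iff.rfl) this)
  apply htri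
  intro s hs
  obtain ⟨a, b, c, hab, hac, hbc, -⟩ := SimpleGraph.is3Clique_iff.1 hs
  obtain ⟨p, hp, tp⟩ := allT a
  obtain ⟨q, hq, tq⟩ := allT b
  obtain ⟨r, hr, tr⟩ := allT c
  have pq : p ≠ q := by rintro rfl; exact stab p hp a b tp tq hab
  have pr : p ≠ r := by rintro rfl; exact stab p hp a c tp tr hac
  have qr : q ≠ r := by rintro rfl; exact stab q hq b c tq tr hbc
  exact g.tri p hp q hq r hr ((M.twins hHouse hBull hp hq pq tp tq).1 hab)
    ((M.twins hHouse hBull hq hr qr tq tr).1 hbc) ((M.twins hHouse hBull hp hr pr tp tr).1 hac)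
end

section
/- If a graph G is not connected, then the quasi-maximal modules of G are exactly the vertex-sets of the connected components of G; likewise, if the complement of G is not connected, then the quasi-maximal modules of G are exactly the vertex-sets of the connected components of the complement of G. -/
open SimpleGraph

theorem isHomogSet_supp_like {V : Type*} (G : SimpleGraph V) (S : Set V)
    (h : ∀ u v, G.Adj u v → u ∈ S → v ∈ S) : IsHomogSet G S := by
  intro v hv
  right
  intro s hs hvs
  exact hv (h s v hvs.symm hs)

theorem exists_adj_cross {V : Type*} (G : SimpleGraph V) (S : Set V) {x y : V}
    (w : G.Walk x y) (hx : x ∈ S) (hy : y ∉ S) :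
    ∃ u v, G.Adj u v ∧ u ∈ S ∧ v ∉ S ∧ G.Reachable v y := by
  induction w with
  | nil => exact absurd hx hy
  | @cons a b c hab p ih =>
    by_cases hb : b ∈ S
    · exact ih hb hy
    · exact ⟨a, b, hab, hx, hb, ⟨p⟩⟩

theorem isModuleSet_supp {V : Type*} (G : SimpleGraph V) (c : G.ConnectedComponent) :
    IsModuleSet G c.supp := by
  have hcl : ∀ u v, G.Adj u v → u ∈ c.supp → v ∈ c.supp := fun u v huv hu =>
    c.mem_supp_of_adj_mem_supp hu huv
  refine ⟨c.nonempty_supp, isHomogSet_supp_like G _ hcl, ?_⟩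
  intro S hS
  by_contra! hcon
  obtain ⟨h1, h2, h3⟩ := hcon
  obtain ⟨z, hzS, hzc⟩ := Set.not_subset.1 h1
  obtain ⟨y, hyc, hyS⟩ := Set.not_subset.1 h2
  obtain ⟨x, hxS, hxc⟩ := h3
  obtain ⟨w⟩ : G.Reachable x y := c.reachable_of_mem_supp hxc hyc
  obtain ⟨u, v, huv, hu, hv, hvy⟩ := exists_adj_cross G S w hxS hyS
  have hvc : v ∈ c.supp := by
    rw [ConnectedComponent.mem_supp_iff] at hyc ⊢
    rw [← hyc]
    exact ConnectedComponent.sound hvy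
  rcases hS v hv with h | h
  · exact hzc (hcl v z (h z hzS) hvc)
  · exact h u hu huv.symm

theorem module_same_component {V : Type*} (G : SimpleGraph V) {M : Set V}
    (hM : IsModuleSet G M) (hne : M ≠ Set.univ) {x y : V} (hx : x ∈ M) (hy : y ∈ M) :
    G.connectedComponentMk x = G.connectedComponentMk y := by
  by_contra hxy
  obtain ⟨v, hv⟩ := (Set.ne_univ_iff_exists_notMem M).1 hne
  have key : ∀ a b : V, a ∈ M → b ∈ M →
      G.connectedComponentMk a ≠ G.connectedComponentMk b →
      G.connectedComponentMk v ≠ G.connectedComponentMk b → False := by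
    intro a b ha hb hab hvb
    have hS : IsHomogSet G {t | G.connectedComponentMk t ≠ G.connectedComponentMk b} := by
      apply isHomogSet_supp_like
      intro s t hst hs
      simp only [Set.mem_setOf_eq] at hs ⊢
      rwa [← ConnectedComponent.connectedComponentMk_eq_of_adj hst]
    rcases hM.2.2 _ hS with h | h | h
    · exact hv (h hvb)
    · exact h hb rfl
    · have : a ∈ ({t | G.connectedComponentMk t ≠ G.connectedComponentMk b} ∩ M : Set V) :=
        ⟨hab, ha⟩
      rw [h] at this
      exact this
  by_cases hvy : G.connectedComponentMk v = G.connectedComponentMk y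
  · exact key y x hy hx (fun h => hxy h.symm) (fun h => hxy (h.symm.trans hvy))
  · exact key x y hx hy hxy hvy

theorem quasiMax_iff_of_not_connected {V : Type*} (G : SimpleGraph V) (hG : ¬ G.Connected)
    (M : Set V) : IsQuasiMaxModule G M ↔ ∃ c : G.ConnectedComponent, M = c.supp := by
  have hcu : ∀ c : G.ConnectedComponent, c.supp ≠ Set.univ := by
    intro c hc
    apply hG
    obtain ⟨x, hx⟩ := c.nonempty_supp
    haveI : Nonempty V := ⟨x⟩
    refine ⟨fun a b => c.reachable_of_mem_supp ?_ ?_⟩ <;> rw [hc] <;> trivial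
  constructor
  · rintro ⟨hM, hne, hmax⟩
    obtain ⟨x, hx⟩ := hM.1
    refine ⟨G.connectedComponentMk x, ?_⟩
    have hsub : M ⊆ (G.connectedComponentMk x).supp := fun y hy =>
      module_same_component G hM hne hy hx
    by_contra h
    exact hcu _ (hmax _ (isModuleSet_supp G _) (hsub.ssubset_of_ne h))
  · rintro ⟨c, rfl⟩
    refine ⟨isModuleSet_supp G c, hcu c, ?_⟩
    intro S hS hlt
    by_contra hne
    obtain ⟨x, hx⟩ := c.nonempty_supp
    apply hlt.2
    intro y hy
    exact (module_same_component G hS hne hy (hlt.1 hx)).trans hx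

theorem isHomogSet_compl_iff {V : Type*} (G : SimpleGraph V) (S : Set V) :
    IsHomogSet Gᶜ S ↔ IsHomogSet G S := by
  have aux : ∀ v ∉ S, ∀ s ∈ S, (Gᶜ.Adj v s ↔ ¬ G.Adj v s) := by
    intro v hv s hs
    have : v ≠ s := fun h => hv (h ▸ hs)
    simp [SimpleGraph.compl_adj, this]
  constructor
  · intro h v hv
    rcases h v hv with h | h
    · right
      intro s hs
      exact (aux v hv s hs).1 (h s hs)
    · left
      intro s hs
      by_contra hn
      exact h s hs ((aux v hv s hs).2 hn)
  · intro h v hv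
    rcases h v hv with h | h
    · right
      intro s hs hn
      exact (aux v hv s hs).1 hn (h s hs)
    · left
      intro s hs
      exact (aux v hv s hs).2 (h s hs)

theorem isQuasiMax_compl_iff {V : Type*} (G : SimpleGraph V) (M : Set V) :
    IsQuasiMaxModule Gᶜ M ↔ IsQuasiMaxModule G M := by
  simp only [IsQuasiMaxModule, IsModuleSet, isHomogSet_compl_iff]

/-- If `G` is not connected, the quasi-maximal modules of `G` are
exactly the vertex-sets of the connected components of `G`; likewise, if `Gᶜ` is
not connected, the quasi-maximal modules of `G` are exactly the vertex-sets of
the connected components of `Gᶜ`. -/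
theorem stmt2 {V : Type*} [Fintype V] (G : SimpleGraph V) :
    (¬ G.Connected →
      ∀ M : Set V, IsQuasiMaxModule G M ↔ ∃ c : G.ConnectedComponent, M = c.supp) ∧
    (¬ Gᶜ.Connected →
      ∀ M : Set V, IsQuasiMaxModule G M ↔ ∃ c : Gᶜ.ConnectedComponent, M = c.supp) := by
  exact ⟨fun h M => quasiMax_iff_of_not_connected G h M, fun h M =>
    (isQuasiMax_compl_iff G M).symm.trans (quasiMax_iff_of_not_connected Gᶜ h M)⟩
end

section
/- In the 5-tuple setup for a (house, bull)-free graph G: for any vertex v ∈ V(G) ∖ (A ∪ B) and any i ∈ {1, …, 4}, v is anticomplete to at least one of A_i and A_{i+1}; moreover, if A_5 is complete to A_1, then v is anticomplete to at least one of A_1 and A_5. -/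
open SimpleGraph

theorem noBull {V : Type*} {G : SimpleGraph V} (h : FreeOf G bull) (a b c d e : V)
    (ab : G.Adj a b) (bc : G.Adj b c) (cd : G.Adj c d) (be : G.Adj b e) (ce : G.Adj c e)
    (ac : ¬ G.Adj a c) (ad : ¬ G.Adj a d) (ae : ¬ G.Adj a e) (bd : ¬ G.Adj b d)
    (de : ¬ G.Adj d e) : False := by
  apply h
  have key : ∀ x y : Fin 5, G.Adj (![a, b, c, d, e] x) (![a, b, c, d, e] y) ↔ bull.Adj x y := by
    intro x y
    fin_cases x <;> fin_cases y <;> simp [bull, *, G.adj_comm]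
  refine ⟨⟨![a, b, c, d, e], ?_⟩, key⟩
  intro x y hxy
  fin_cases x <;> fin_cases y <;> simp at hxy ⊢ <;> grind [G.adj_comm, SimpleGraph.irrefl]

/-- `a b c d` is an induced four-cycle and `e` is the roof over the edge `a b`. -/
theorem noHouse {V : Type*} {G : SimpleGraph V} (h : FreeOf G house) (a b c d e : V)
    (ab : G.Adj a b) (bc : G.Adj b c) (cd : G.Adj c d) (da : G.Adj d a) (ea : G.Adj e a)
    (eb : G.Adj e b)
    (ac : ¬ G.Adj a c) (bd : ¬ G.Adj b d) (ec : ¬ G.Adj e c) (ed : ¬ G.Adj e d) : False := by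
  apply h
  have ne : ∀ x y, G.Adj x y → x ≠ y := fun x y h => h.ne
  have h1 : a ≠ c := by grind [G.adj_comm]
  have h2 : b ≠ d := by grind [G.adj_comm]
  have h3 : e ≠ c := by grind [G.adj_comm]
  have h4 : e ≠ d := by grind [G.adj_comm]
  have key : ∀ x y : Fin 5, G.Adj (![a, c, e, d, b] x) (![a, c, e, d, b] y) ↔ house.Adj x y := by
    intro x y
    fin_cases x <;> fin_cases y <;> simp [house, SimpleGraph.pathGraph_adj] <;>
      grind [G.adj_comm]
  refine ⟨⟨![a, c, e, d, b], ?_⟩, key⟩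
  intro x y hxy
  fin_cases x <;> fin_cases y <;> simp at hxy ⊢ <;> grind [G.adj_comm]

theorem extend {V : Type*} {G : SimpleGraph V} {A : Fin 5 → Set V} (hA : MaximalGoodTuple G A)
    (v : V) (hv : v ∉ ⋃ i, A i) (k : Fin 5)
    (h1 : ∀ j ≠ k, CompleteTo G (A k) (A j) → ∀ x ∈ A j, G.Adj v x)
    (h2 : ∀ j ≠ k, AnticompleteTo G (A k) (A j) → ∀ x ∈ A j, ¬ G.Adj v x) : False := by
  obtain ⟨⟨n, d, c, a, e⟩, m⟩ := hA
  have hv' : ∀ i, v ∉ A i := by simpa using hv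
  set A' : Fin 5 → Set V := fun i => if i = k then insert v (A i) else A i with hA'
  have sub : ∀ i, A i ⊆ A' i := by
    intro i x hx
    simp only [hA']; split_ifs <;> simp [hx]
  have mem : ∀ i x, x ∈ A' i → x ∈ A i ∨ (x = v ∧ i = k) := by
    intro i x hx
    simp only [hA'] at hx; split_ifs at hx <;> simp_all <;> tauto
  have hc : ∀ i j, i ≠ j → CompleteTo G (A i) (A j) → CompleteTo G (A' i) (A' j) := by
    intro i j hij h s hs t ht
    have h' : CompleteTo G (A j) (A i) := fun x hx y hy => (h y hy x hx).symm
    rcases mem i s hs with hs' | ⟨rfl, rfl⟩ <;> rcases mem j t ht with ht | ⟨rfl, rfl⟩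
    · exact h s hs' t ht
    · exact (h1 i hij h' s hs').symm
    · exact h1 j hij.symm h t ht
    · exact absurd rfl hij
  have ha : ∀ i j, i ≠ j → AnticompleteTo G (A i) (A j) → AnticompleteTo G (A' i) (A' j) := by
    intro i j hij h s hs t ht
    have h' : AnticompleteTo G (A j) (A i) := fun x hx y hy hxy => (h y hy x hx) hxy.symm
    rcases mem i s hs with hs' | ⟨rfl, rfl⟩ <;> rcases mem j t ht with ht | ⟨rfl, rfl⟩
    · exact h s hs' t ht
    · exact fun q => (h2 i hij h' s hs') q.symm
    · exact h2 j hij.symm h t ht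
    · exact absurd rfl hij
  refine m A' ⟨fun i => (n i).mono (sub i), ?_, ?_, ?_, ?_⟩ ⟨Set.iUnion_mono sub, ?_⟩
  · intro i j hij
    rw [Set.disjoint_left]
    intro x hx hx'
    have := Set.disjoint_left.1 (d hij)
    rcases mem i x hx with hs | ⟨rfl, rfl⟩ <;> rcases mem j x hx' with ht | ⟨h, rfl⟩
    · exact this hs ht
    · exact hv' i (h ▸ hs)
    · exact hv' j ht
    · exact absurd rfl hij
  · intro i hi; exact hc i _ (by revert i; decide) (c i hi)
  · intro i; exact ha i _ (by revert i; decide) (a i)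
  · exact e.imp (hc _ _ (by decide)) (ha _ _ (by decide))
  · intro h
    exact hv (h (Set.mem_iUnion.2 ⟨k, by simp [hA']⟩))

/-- Classification of the neighbourhood of `v` on an induced path. -/
theorem classP {V : Type*} {G : SimpleGraph V} (hH : FreeOf G house) (hB : FreeOf G bull)
    (v a b c d e : V) (ab : G.Adj a b) (bc : G.Adj b c) (cd : G.Adj c d) (de : G.Adj d e)
    (ac : ¬ G.Adj a c) (ad : ¬ G.Adj a d) (bd : ¬ G.Adj b d)
    (be : ¬ G.Adj b e) (ce : ¬ G.Adj c e) (ae : ¬ G.Adj a e)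
    (h : (G.Adj v a ∧ G.Adj v b) ∨ (G.Adj v b ∧ G.Adj v c) ∨ (G.Adj v c ∧ G.Adj v d) ∨
      (G.Adj v d ∧ G.Adj v e)) :
    (G.Adj v a ∧ G.Adj v b ∧ ¬ G.Adj v d ∧ ¬ G.Adj v e) ∨
    (¬ G.Adj v a ∧ G.Adj v b ∧ G.Adj v c ∧ G.Adj v d ∧ ¬ G.Adj v e) ∨
    (¬ G.Adj v a ∧ ¬ G.Adj v b ∧ G.Adj v d ∧ G.Adj v e) ∨
    (G.Adj v a ∧ G.Adj v b ∧ G.Adj v c ∧ G.Adj v d ∧ G.Adj v e) := by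
  have k0 : G.Adj v b → G.Adj v c → ¬ G.Adj v a → ¬ G.Adj v d → False := by
    intros
    apply noBull hB a b c d v <;> first
      | assumption
      | exact SimpleGraph.Adj.symm (by assumption)
      | exact mt SimpleGraph.Adj.symm (by assumption)
  have k1 : G.Adj v c → G.Adj v d → ¬ G.Adj v b → ¬ G.Adj v e → False := by
    intros
    apply noBull hB b c d e v <;> first
      | assumption
      | exact SimpleGraph.Adj.symm (by assumption)
      | exact mt SimpleGraph.Adj.symm (by assumption)
  have k2 : G.Adj v a → G.Adj v b → G.Adj v d → ¬ G.Adj v c → False := by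
    intros
    apply noHouse hH v b c d a <;> first
      | assumption
      | exact SimpleGraph.Adj.symm (by assumption)
      | exact mt SimpleGraph.Adj.symm (by assumption)
  have k3 : G.Adj v a → G.Adj v b → G.Adj v e → ¬ G.Adj v c → False := by
    intros
    apply noBull hB e v b c a <;> first
      | assumption
      | exact SimpleGraph.Adj.symm (by assumption)
      | exact mt SimpleGraph.Adj.symm (by assumption)
  have k4 : G.Adj v a → G.Adj v c → G.Adj v d → ¬ G.Adj v e → False := by
    intros
    apply noBull hB a v d e c <;> first
      | assumption
      | exact SimpleGraph.Adj.symm (by assumption)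
      | exact mt SimpleGraph.Adj.symm (by assumption)
  have k5 : G.Adj v b → G.Adj v c → G.Adj v e → ¬ G.Adj v d → False := by
    intros
    apply noHouse hH v c d e b <;> first
      | assumption
      | exact SimpleGraph.Adj.symm (by assumption)
      | exact mt SimpleGraph.Adj.symm (by assumption)
  have k6 : G.Adj v e → G.Adj v d → G.Adj v b → ¬ G.Adj v c → False := by
    intros
    apply noHouse hH v d c b e <;> first
      | assumption
      | exact SimpleGraph.Adj.symm (by assumption)
      | exact mt SimpleGraph.Adj.symm (by assumption)
  have k7 : G.Adj v e → G.Adj v d → G.Adj v a → ¬ G.Adj v c → False := by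
    intros
    apply noBull hB a v d c e <;> first
      | assumption
      | exact SimpleGraph.Adj.symm (by assumption)
      | exact mt SimpleGraph.Adj.symm (by assumption)
  have k8 : G.Adj v e → G.Adj v c → G.Adj v b → ¬ G.Adj v a → False := by
    intros
    apply noBull hB e v b a c <;> first
      | assumption
      | exact SimpleGraph.Adj.symm (by assumption)
      | exact mt SimpleGraph.Adj.symm (by assumption)
  have k9 : G.Adj v d → G.Adj v c → G.Adj v a → ¬ G.Adj v b → False := by
    intros
    apply noHouse hH v c b a d <;> first
      | assumption
      | exact SimpleGraph.Adj.symm (by assumption)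
      | exact mt SimpleGraph.Adj.symm (by assumption)
  clear ab bc cd de ac ad bd be ce ae
  grind

/-- Classification of the neighbourhood of `v` on an induced five-cycle. -/
theorem classC {V : Type*} {G : SimpleGraph V} (hH : FreeOf G house) (hB : FreeOf G bull)
    (v a b c d e : V) (ab : G.Adj a b) (bc : G.Adj b c) (cd : G.Adj c d) (de : G.Adj d e)
    (ea : G.Adj e a)
    (ac : ¬ G.Adj a c) (ad : ¬ G.Adj a d) (bd : ¬ G.Adj b d)
    (be : ¬ G.Adj b e) (ce : ¬ G.Adj c e)
    (va : G.Adj v a) (vb : G.Adj v b) :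
    (G.Adj v c ∧ ¬ G.Adj v d ∧ ¬ G.Adj v e) ∨
    (¬ G.Adj v c ∧ ¬ G.Adj v d ∧ G.Adj v e) ∨
    (G.Adj v c ∧ G.Adj v d ∧ G.Adj v e) := by
  have k0 : ¬ G.Adj v c → ¬ G.Adj v e → False := by
    intros
    apply noBull hB e a b c v <;> first
      | assumption
      | exact SimpleGraph.Adj.symm (by assumption)
      | exact mt SimpleGraph.Adj.symm (by assumption)
  have k1 : G.Adj v d → ¬ G.Adj v c → False := by
    intros
    apply noHouse hH v b c d a <;> first
      | assumption
      | exact SimpleGraph.Adj.symm (by assumption)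
      | exact mt SimpleGraph.Adj.symm (by assumption)
  have k2 : G.Adj v d → ¬ G.Adj v e → False := by
    intros
    apply noHouse hH v a e d b <;> first
      | assumption
      | exact SimpleGraph.Adj.symm (by assumption)
      | exact mt SimpleGraph.Adj.symm (by assumption)
  have k3 : G.Adj v c → G.Adj v e → ¬ G.Adj v d → False := by
    intros
    apply noHouse hH v c d e b <;> first
      | assumption
      | exact SimpleGraph.Adj.symm (by assumption)
      | exact mt SimpleGraph.Adj.symm (by assumption)
  tauto

theorem twist {V : Type*} {G : SimpleGraph V} (hH : FreeOf G house) (hB : FreeOf G bull)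
    (v p q q' r s : V) (pq : G.Adj p q) (pq' : G.Adj p q') (qr : G.Adj q r) (qr' : G.Adj q' r)
    (rs : G.Adj r s) (pr : ¬ G.Adj p r) (qs : ¬ G.Adj q s) (qs' : ¬ G.Adj q' s)
    (vp : G.Adj v p) (vq : G.Adj v q) (vr : ¬ G.Adj v r) (vs : ¬ G.Adj v s) : G.Adj v q' := by
  by_contra vq'
  by_cases h : G.Adj q q'
  · apply noBull hB v q r s q' <;> first
      | assumption
      | exact SimpleGraph.Adj.symm (by assumption)
      | exact mt SimpleGraph.Adj.symm (by assumption)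
  · apply noHouse hH p q r q' v <;> first
      | assumption
      | exact SimpleGraph.Adj.symm (by assumption)
      | exact mt SimpleGraph.Adj.symm (by assumption)

theorem cycCase {V : Type*} {G : SimpleGraph V} (hH : FreeOf G house) (hB : FreeOf G bull)
    (v : V) (S0 S1 S2 S3 S4 : Set V)
    (n2 : S2.Nonempty) (n3 : S3.Nonempty) (n4 : S4.Nonempty)
    (c01 : CompleteTo G S0 S1) (c12 : CompleteTo G S1 S2) (c23 : CompleteTo G S2 S3)
    (c34 : CompleteTo G S3 S4) (c40 : CompleteTo G S4 S0)
    (a02 : AnticompleteTo G S0 S2) (a13 : AnticompleteTo G S1 S3) (a24 : AnticompleteTo G S2 S4)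
    (a30 : AnticompleteTo G S3 S0) (a41 : AnticompleteTo G S4 S1)
    (x : V) (hx : x ∈ S0) (y : V) (hy : y ∈ S1) (vx : G.Adj v x) (vy : G.Adj v y) :
    (CompleteTo G {v} S4 ∧ CompleteTo G {v} S1 ∧ AnticompleteTo G {v} S2 ∧
      AnticompleteTo G {v} S3) ∨
    (CompleteTo G {v} S0 ∧ CompleteTo G {v} S2 ∧ AnticompleteTo G {v} S3 ∧
      AnticompleteTo G {v} S4) ∨
    (CompleteTo G {v} S0 ∧ CompleteTo G {v} S1 ∧ CompleteTo G {v} S2 ∧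
      CompleteTo G {v} S3 ∧ CompleteTo G {v} S4) := by
  have R : ∀ a ∈ S0, ∀ b ∈ S1, ∀ c ∈ S2, ∀ d ∈ S3, ∀ e ∈ S4,
      (G.Adj a b ∧ G.Adj b c ∧ G.Adj c d ∧ G.Adj d e ∧ G.Adj e a) ∧
      (¬ G.Adj a c ∧ ¬ G.Adj b d ∧ ¬ G.Adj c e ∧ ¬ G.Adj d a ∧ ¬ G.Adj e b) :=
    fun a ha b hb c hc d hd e he =>
      ⟨⟨c01 a ha b hb, c12 b hb c hc, c23 c hc d hd, c34 d hd e he, c40 e he a ha⟩,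
        a02 a ha c hc, a13 b hb d hd, a24 c hc e he, a30 d hd a ha, a41 e he b hb⟩
  have sy := G.adj_comm
  simp only [CompleteTo, AnticompleteTo, Set.mem_singleton_iff, forall_eq]
  obtain ⟨z, hz⟩ := n2
  obtain ⟨w, hw⟩ := n3
  obtain ⟨u, hu⟩ := n4
  have K' : ∀ a ∈ S0, ∀ b ∈ S1, ∀ c ∈ S2, ∀ d ∈ S3, ∀ e ∈ S4,
      (G.Adj v a ∧ G.Adj v b ∨ G.Adj v b ∧ G.Adj v c ∨ G.Adj v e ∧ G.Adj v a) →
      (G.Adj v a ∧ G.Adj v b ∧ G.Adj v c ∧ G.Adj v d ∧ G.Adj v e) ∨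
      (G.Adj v a ∧ G.Adj v b ∧ G.Adj v c ∧ ¬ G.Adj v d ∧ ¬ G.Adj v e) ∨
      (G.Adj v a ∧ G.Adj v b ∧ ¬ G.Adj v c ∧ ¬ G.Adj v d ∧ G.Adj v e) ∨
      (¬ G.Adj v a ∧ G.Adj v b ∧ G.Adj v c ∧ G.Adj v d ∧ ¬ G.Adj v e) ∨
      (G.Adj v a ∧ ¬ G.Adj v b ∧ ¬ G.Adj v c ∧ G.Adj v d ∧ G.Adj v e) := by
    intro a ha b hb c hc d hd e he h
    obtain ⟨⟨ab, bc, cd, de, ea⟩, ac, bd, ce, da, eb⟩ := R a ha b hb c hc d hd e he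
    have ca := mt (sy c a).1 ac
    have ec := mt (sy e c).1 ce
    have ad := mt (sy a d).1 da
    have be := mt (sy b e).1 eb
    have K1 := classC hH hB v a b c d e ab bc cd de ea ac ad bd be ce
    have K2 := classC hH hB v b c d e a bc cd de ea ab bd be ce ca da
    have K3 := classC hH hB v e a b c d ea ab bc cd de eb ec ac ad bd
    clear sy R c01 c12 c23 c34 c40 a02 a13 a24 a30 a41
    clear ab bc cd de ea ac bd ce da eb ca ec ad be
    rcases h with ⟨h1, h2⟩ | ⟨h1, h2⟩ | ⟨h1, h2⟩
    · have := K1 h1 h2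
      clear K1 K2 K3; grind
    · have := K2 h1 h2
      clear K1 K2 K3; grind
    · have := K3 h1 h2
      clear K1 K2 K3; grind
  clear R sy
  have k0 := fun a ha => K' a ha y hy z hz w hw u hu
  have k1 := fun b hb => K' x hx b hb z hz w hw u hu
  have k2 := fun c hc => K' x hx y hy c hc w hw u hu
  have k3 := fun d hd => K' x hx y hy z hz d hd u hu
  have k4 := fun e he => K' x hx y hy z hz w hw e he
  have k := k0 x hx (Or.inl ⟨vx, vy⟩)
  clear K' c01 c12 c23 c34 c40 a02 a13 a24 a30 a41
  rcases k with k | k | k | k | k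
  · right; right; grind
  · right; left; grind
  · left; grind
  · exact absurd vx k.1
  · exact absurd vy k.2.1

theorem pathCase {V : Type*} {G : SimpleGraph V} (hH : FreeOf G house) (hB : FreeOf G bull)
    (v : V) (S0 S1 S2 S3 S4 : Set V)
    (c01 : CompleteTo G S0 S1) (c12 : CompleteTo G S1 S2) (c23 : CompleteTo G S2 S3)
    (c34 : CompleteTo G S3 S4) (a40 : AnticompleteTo G S4 S0)
    (a02 : AnticompleteTo G S0 S2) (a13 : AnticompleteTo G S1 S3) (a24 : AnticompleteTo G S2 S4)
    (a30 : AnticompleteTo G S3 S0) (a41 : AnticompleteTo G S4 S1)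
    (x : V) (hx : x ∈ S0) (y : V) (hy : y ∈ S1) (z : V) (hz : z ∈ S2) (w : V) (hw : w ∈ S3)
    (u : V) (hu : u ∈ S4)
    (h : (G.Adj v x ∧ G.Adj v y) ∨ (G.Adj v y ∧ G.Adj v z) ∨ (G.Adj v z ∧ G.Adj v w) ∨
      (G.Adj v w ∧ G.Adj v u)) :
    (CompleteTo G {v} S1 ∧ AnticompleteTo G {v} S2 ∧
      AnticompleteTo G {v} S3 ∧ AnticompleteTo G {v} S4) ∨
    (CompleteTo G {v} S0 ∧ CompleteTo G {v} S2 ∧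
      AnticompleteTo G {v} S3 ∧ AnticompleteTo G {v} S4) ∨
    (CompleteTo G {v} S1 ∧ CompleteTo G {v} S3 ∧
      AnticompleteTo G {v} S0 ∧ AnticompleteTo G {v} S4) ∨
    (CompleteTo G {v} S4 ∧ CompleteTo G {v} S2 ∧
      AnticompleteTo G {v} S1 ∧ AnticompleteTo G {v} S0) ∨
    (CompleteTo G {v} S3 ∧ AnticompleteTo G {v} S2 ∧
      AnticompleteTo G {v} S1 ∧ AnticompleteTo G {v} S0) ∨
    (CompleteTo G {v} S0 ∧ CompleteTo G {v} S1 ∧ CompleteTo G {v} S2 ∧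
      CompleteTo G {v} S3 ∧ CompleteTo G {v} S4) := by
  have K : ∀ a ∈ S0, ∀ b ∈ S1, ∀ c ∈ S2, ∀ d ∈ S3, ∀ e ∈ S4, _ := fun a ha b hb c hc d hd e he =>
    classP hH hB v a b c d e (c01 a ha b hb) (c12 b hb c hc) (c23 c hc d hd) (c34 d hd e he)
      (a02 a ha c hc) (fun q => a30 d hd a ha q.symm) (a13 b hb d hd)
      (fun q => a41 e he b hb q.symm) (a24 c hc e he) (fun q => a40 e he a ha q.symm)
  have t1 : ∀ b ∈ S1, ∀ b' ∈ S1, _ := fun b hb b' hb' =>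
    twist hH hB v x b b' z w (c01 x hx b hb) (c01 x hx b' hb') (c12 b hb z hz) (c12 b' hb' z hz)
      (c23 z hz w hw) (a02 x hx z hz) (a13 b hb w hw) (a13 b' hb' w hw)
  have t2 : ∀ c ∈ S2, ∀ c' ∈ S2, _ := fun c hc c' hc' =>
    twist hH hB v y c c' w u (c12 y hy c hc) (c12 y hy c' hc') (c23 c hc w hw) (c23 c' hc' w hw)
      (c34 w hw u hu) (a13 y hy w hw) (a24 c hc u hu) (a24 c' hc' u hu)
  have t3 : ∀ d ∈ S3, ∀ d' ∈ S3, _ := fun d hd d' hd' =>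
    twist hH hB v u d d' z y (c34 d hd u hu).symm (c34 d' hd' u hu).symm
      (c23 z hz d hd).symm (c23 z hz d' hd').symm
      (c12 y hy z hz).symm (fun q => a24 z hz u hu q.symm) (fun q => a13 y hy d hd q.symm)
      (fun q => a13 y hy d' hd' q.symm)
  have t4 : ∀ c ∈ S2, ∀ c' ∈ S2, _ := fun c hc c' hc' =>
    twist hH hB v w c c' y x (c23 c hc w hw).symm (c23 c' hc' w hw).symm
      (c12 y hy c hc).symm (c12 y hy c' hc').symm
      (c01 x hx y hy).symm (fun q => a13 y hy w hw q.symm) (fun q => a02 x hx c hc q.symm)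
      (fun q => a02 x hx c' hc' q.symm)
  simp only [CompleteTo, AnticompleteTo, Set.mem_singleton_iff, forall_eq]
  have k0 := fun a ha => K a ha y hy z hz w hw u hu
  have k1 := fun b hb => K x hx b hb z hz w hw u hu
  have k2 := fun c hc => K x hx y hy c hc w hw u hu
  have k3 := fun d hd => K x hx y hy z hz d hd u hu
  have k4 := fun e he => K x hx y hy z hz w hw e he
  have k := k0 x hx h
  replace t1 := t1 y hy
  replace t3 := t3 w hw
  have t2a := t2 z hz
  have t2b := fun c hc => t2 c hc z hz
  have t4a := t4 z hz
  have t4b := fun c hc => t4 c hc z hz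
  clear K t2 t4 c01 c12 c23 c34 a40 a02 a13 a24 a30 a41
  rcases k with k | k | k | k
  · by_cases vz : G.Adj v z
    · right; left; grind
    · left; grind
  · right; right; left; grind
  · by_cases vz : G.Adj v z
    · right; right; right; left; grind
    · right; right; right; right; left; grind
  · right; right; right; right; right; grind

/-- In the 5-tuple setup for a (house, bull)-free graph `G`:
for any vertex `v ∉ A ∪ B` and any `i ∈ {1, …, 4}` (here `i ≠ 4` in 0-indexing),
`v` is anticomplete to at least one of `A i` and `A (i+1)`; moreover, if `A 4`
is complete to `A 0`, then `v` is anticomplete to at least one of `A 0`, `A 4`. -/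
theorem stmt10 {V : Type*} [Fintype V] (G : SimpleGraph V)
    (hHouse : FreeOf G house) (hBull : FreeOf G bull)
    (A : Fin 5 → Set V) (hA : MaximalGoodTuple G A)
    (v : V) (hv : v ∉ (⋃ i, A i) ∪ Bset G A) :
    (∀ i : Fin 5, i ≠ 4 →
      AnticompleteTo G {v} (A i) ∨ AnticompleteTo G {v} (A (i + 1))) ∧
    (CompleteTo G (A 4) (A 0) →
      AnticompleteTo G {v} (A 0) ∨ AnticompleteTo G {v} (A 4)) := by
  obtain ⟨hvA, hvB⟩ : v ∉ (⋃ i, A i) ∧ v ∉ Bset G A := by simpa [not_or] using hv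
  have notall : ¬ ∀ i, CompleteTo G {v} (A i) := by
    intro h
    refine hvB ⟨hvA, fun a ha => ?_⟩
    obtain ⟨i, hi⟩ := Set.mem_iUnion.1 ha
    exact h i v rfl a hi
  obtain ⟨⟨n, d, c, a, e⟩, m⟩ := id hA
  -- adding `v` to the part `A k`, in terms of the offsets from `k`
  have notboth : ∀ i j, CompleteTo G (A i) (A j) → AnticompleteTo G (A i) (A j) → False := by
    intro i j h h'
    obtain ⟨s, hs⟩ := n i
    obtain ⟨t, ht⟩ := n j
    exact h' s hs t ht (h s hs t ht)
  have sc : ∀ i j, CompleteTo G (A i) (A j) → CompleteTo G (A j) (A i) :=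
    fun i j h s hs t ht => (h t ht s hs).symm
  have sa : ∀ i j, AnticompleteTo G (A i) (A j) → AnticompleteTo G (A j) (A i) :=
    fun i j h s hs t ht q => h t ht s hs q.symm
  have ext : ∀ k, (∀ j ≠ k, (CompleteTo G (A k) (A j) ∧ CompleteTo G {v} (A j)) ∨
      (AnticompleteTo G (A k) (A j) ∧ AnticompleteTo G {v} (A j))) → False := by
    intro k h
    refine extend hA v hvA k (fun j hj hc => ?_) (fun j hj hc => ?_)
    · rcases h j hj with ⟨_, h⟩ | ⟨h', _⟩
      · exact h v rfl
      · exact (notboth _ _ hc h').elim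
    · rcases h j hj with ⟨h', _⟩ | ⟨_, h⟩
      · exact (notboth _ _ h' hc).elim
      · exact h v rfl
  have nbr : ∀ i, ¬ AnticompleteTo G {v} (A i) → ∃ x ∈ A i, G.Adj v x := by
    intro i h
    simpa [AnticompleteTo] using h
  have c01 : CompleteTo G (A 0) (A 1) := c 0 (by decide)
  have c12 : CompleteTo G (A 1) (A 2) := c 1 (by decide)
  have c23 : CompleteTo G (A 2) (A 3) := c 2 (by decide)
  have c34 : CompleteTo G (A 3) (A 4) := c 3 (by decide)
  have a02 : AnticompleteTo G (A 0) (A 2) := a 0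
  have a13 : AnticompleteTo G (A 1) (A 3) := a 1
  have a24 : AnticompleteTo G (A 2) (A 4) := a 2
  have a30 : AnticompleteTo G (A 3) (A 0) := a 3
  have a41 : AnticompleteTo G (A 4) (A 1) := a 4
  rcases e with e | e
  · have cc : ∀ i j, j = i + 1 → CompleteTo G (A i) (A j) := by
      rintro i j rfl
      by_cases hi : i = 4
      · subst hi; exact e
      · exact c i hi
    have aa : ∀ i j, j = i + 2 → AnticompleteTo G (A i) (A j) := by
      rintro i j rfl; exact a i
    have main : ∀ i : Fin 5, AnticompleteTo G {v} (A i) ∨ AnticompleteTo G {v} (A (i + 1)) := by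
      intro i
      by_contra hcon
      rw [not_or] at hcon
      obtain ⟨x, hx, vx⟩ := nbr _ hcon.1
      obtain ⟨y, hy, vy⟩ := nbr _ hcon.2
      have := cycCase hHouse hBull v (A i) (A (i + 1)) (A (i + 2)) (A (i + 3)) (A (i + 4))
        (n _) (n _) (n _) (cc _ _ (by clear * - i; revert i; decide)) (cc _ _ (by clear * - i; revert i; decide)) (cc _ _ (by clear * - i; revert i; decide))
        (cc _ _ (by clear * - i; revert i; decide)) (cc _ _ (by clear * - i; revert i; decide)) (aa _ _ (by clear * - i; revert i; decide)) (aa _ _ (by clear * - i; revert i; decide))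
        (aa _ _ (by clear * - i; revert i; decide)) (aa _ _ (by clear * - i; revert i; decide)) (aa _ _ (by clear * - i; revert i; decide))
        x hx y hy vx vy
      have cases5 : ∀ j : Fin 5, j = i ∨ j = i + 1 ∨ j = i + 2 ∨ j = i + 3 ∨ j = i + 4 := by
        clear * - i; revert i; decide
      rcases this with ⟨h4, h1, h2, h3⟩ | ⟨h0, h2, h3, h4⟩ | ⟨h0, h1, h2, h3, h4⟩
      · refine ext i fun j hj => ?_
        rcases cases5 j with rfl | rfl | rfl | rfl | rfl
        · exact absurd rfl hj
        · exact Or.inl ⟨cc _ _ (by clear * - i; revert i; decide), h1⟩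
        · exact Or.inr ⟨aa _ _ (by clear * - i; revert i; decide), h2⟩
        · exact Or.inr ⟨sa _ _ (aa _ _ (by clear * - i; revert i; decide)), h3⟩
        · exact Or.inl ⟨sc _ _ (cc _ _ (by clear * - i; revert i; decide)), h4⟩
      · refine ext (i + 1) fun j hj => ?_
        rcases cases5 j with rfl | rfl | rfl | rfl | rfl
        · exact Or.inl ⟨sc _ _ (cc _ _ rfl), h0⟩
        · exact absurd rfl hj
        · exact Or.inl ⟨cc _ _ (by clear * - i; revert i; decide), h2⟩
        · exact Or.inr ⟨aa _ _ (by clear * - i; revert i; decide), h3⟩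
        · exact Or.inr ⟨sa _ _ (aa _ _ (by clear * - i; revert i; decide)), h4⟩
      · refine notall fun j => ?_
        rcases cases5 j with rfl | rfl | rfl | rfl | rfl <;> assumption
    exact ⟨fun i _ => main i, fun _ => (main 4).symm⟩
  · refine ⟨?_, fun h => (notboth _ _ h e).elim⟩
    have main : ∀ x ∈ A 0, ∀ y ∈ A 1, ∀ z ∈ A 2, ∀ w ∈ A 3, ∀ u ∈ A 4,
        ((G.Adj v x ∧ G.Adj v y) ∨ (G.Adj v y ∧ G.Adj v z) ∨ (G.Adj v z ∧ G.Adj v w) ∨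
          (G.Adj v w ∧ G.Adj v u)) → False := by
      intro x hx y hy z hz w hw u hu h
      have := pathCase hHouse hBull v (A 0) (A 1) (A 2) (A 3) (A 4) c01 c12 c23 c34 e
        a02 a13 a24 a30 a41 x hx y hy z hz w hw u hu h
      have c10 := sc _ _ c01
      have c21 := sc _ _ c12
      have c32 := sc _ _ c23
      have c43 := sc _ _ c34
      have a20 := sa _ _ a02
      have a31 := sa _ _ a13
      have a42 := sa _ _ a24
      have a03 := sa _ _ a30
      have a14 := sa _ _ a41
      have a04 := sa _ _ e
      rcases this with h | h | h | h | h | h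
      · refine ext 0 fun j hj => ?_
        fin_cases j <;> simp at hj ⊢ <;> simp [*]
      · refine ext 1 fun j hj => ?_
        fin_cases j <;> simp at hj ⊢ <;> simp [*]
      · refine ext 2 fun j hj => ?_
        fin_cases j <;> simp at hj ⊢ <;> simp [*]
      · refine ext 3 fun j hj => ?_
        fin_cases j <;> simp at hj ⊢ <;> simp [*]
      · refine ext 4 fun j hj => ?_
        fin_cases j <;> simp at hj ⊢ <;> simp [*]
      · refine notall fun j => ?_
        fin_cases j <;> simp [h]
    obtain ⟨p0, hp0⟩ := n 0
    obtain ⟨p1, hp1⟩ := n 1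
    obtain ⟨p2, hp2⟩ := n 2
    obtain ⟨p3, hp3⟩ := n 3
    obtain ⟨p4, hp4⟩ := n 4
    intro i hi
    by_contra hcon
    rw [not_or] at hcon
    obtain ⟨x, hx, vx⟩ := nbr _ hcon.1
    obtain ⟨y, hy, vy⟩ := nbr _ hcon.2
    fin_cases i
    · exact main x hx y hy p2 hp2 p3 hp3 p4 hp4 (by tauto)
    · exact main p0 hp0 x hx y hy p3 hp3 p4 hp4 (by tauto)
    · exact main p0 hp0 p1 hp1 x hx y hy p4 hp4 (by tauto)
    · exact main p0 hp0 p1 hp1 p2 hp2 x hx y hy (by tauto)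
    · exact hi rfl
end
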